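/- arXiv:2004.08429 — 2 statements merged into one kernel-verified Lean document; each statement's English description precedes it below -/
import Mathlib

section
/- Equality case of Grünbaum's conjecture: let P be a d-polytope with d+s vertices where 2 ≤ s ≤ d. If f_k(P) = φ_k(d+s,d) for some 1 ≤ k ≤ d-2, then P is combinatorially equivalent to the dual of the (d-s)-fold pyramid over the bipyramid over an (s-1)-simplex. -/
open Set

/-- `C n m` : binomial coefficient with the convention `C n m = 0` for `n < 0`. -/
def C (n : ℤ) (m : ℕ) : ℤ := if n < 0 then 0 else (n.toNat).choose m

/-- Grünbaum's lower bound function `φ_k(d+s, d)`. -/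
def phi (d s k : ℕ) : ℤ := C (d + 1) (k + 1) + C d (k + 1) - C ((d : ℤ) + 1 - s) (k + 1)

/-- A polytope: convex hull of a finite set of points. -/
def IsPolytope {N : ℕ} (P : Set (EuclideanSpace ℝ (Fin N))) : Prop :=
  ∃ V : Finset (EuclideanSpace ℝ (Fin N)), P = convexHull ℝ (V : Set (EuclideanSpace ℝ (Fin N)))

/-- The dimension of a set: the dimension of its affine span. -/
noncomputable def pdim {N : ℕ} (P : Set (EuclideanSpace ℝ (Fin N))) : ℕ :=
  Module.finrank ℝ (affineSpan ℝ P).direction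

/-- `F` is a face of `P`: the intersection of `P` with a supporting hyperplane
(the linear functional may be zero, so `P` itself is a face; `F` may be empty). -/
def IsFace {N : ℕ} (P F : Set (EuclideanSpace ℝ (Fin N))) : Prop :=
  ∃ (f : EuclideanSpace ℝ (Fin N) →ₗ[ℝ] ℝ) (c : ℝ),
    (∀ x ∈ P, f x ≤ c) ∧ F = {x ∈ P | f x = c}

/-- The set of vertices of `P` (points whose singleton is a face of `P`). -/
def vertexSet {N : ℕ} (P : Set (EuclideanSpace ℝ (Fin N))) : Set (EuclideanSpace ℝ (Fin N)) :=
  {v | IsFace P {v}}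

/-- The number of (nonempty) `k`-dimensional faces of `P`. -/
noncomputable def fCount {N : ℕ} (P : Set (EuclideanSpace ℝ (Fin N))) (k : ℕ) : ℕ :=
  {F : Set (EuclideanSpace ℝ (Fin N)) | IsFace P F ∧ F.Nonempty ∧ pdim F = k}.ncard

/-- `P` is a `k`-dimensional simplex. -/
def IsSimplex {N : ℕ} (P : Set (EuclideanSpace ℝ (Fin N))) (k : ℕ) : Prop :=
  ∃ V : Finset (EuclideanSpace ℝ (Fin N)), V.card = k + 1 ∧
    AffineIndependent ℝ (Subtype.val : {x // x ∈ V} → EuclideanSpace ℝ (Fin N)) ∧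
    P = convexHull ℝ (V : Set (EuclideanSpace ℝ (Fin N)))

/-- `Q` is a pyramid over `P`. -/
def IsPyramid {N : ℕ} (Q P : Set (EuclideanSpace ℝ (Fin N))) : Prop :=
  ∃ x, x ∉ affineSpan ℝ P ∧ Q = convexHull ℝ (insert x P)

/-- `Q` is an `r`-fold pyramid over `P`. -/
def IsFoldPyramid {N : ℕ} : ℕ → Set (EuclideanSpace ℝ (Fin N)) → Set (EuclideanSpace ℝ (Fin N)) → Prop
  | 0, Q, P => Q = P
  | (r + 1), Q, P => ∃ R, IsFoldPyramid r R P ∧ IsPyramid Q R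

/-- `Q` is a bipyramid over `P`: the two apices span a segment whose interior
meets the relative interior of `P`. -/
def IsBipyramid {N : ℕ} (Q P : Set (EuclideanSpace ℝ (Fin N))) : Prop :=
  ∃ x y, x ∉ affineSpan ℝ P ∧ y ∉ affineSpan ℝ P ∧
    (openSegment ℝ x y ∩ intrinsicInterior ℝ P).Nonempty ∧
    Q = convexHull ℝ (P ∪ {x, y})

/-- `Q` is the direct sum (free sum) of `P₁` and `P₂`: their affine spans meet in a single
point that is in the relative interior of each. -/
def IsDirectSum {N : ℕ} (Q P₁ P₂ : Set (EuclideanSpace ℝ (Fin N))) : Prop :=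
  ∃ z, (affineSpan ℝ P₁ : Set (EuclideanSpace ℝ (Fin N))) ∩ (affineSpan ℝ P₂) = {z} ∧
    z ∈ intrinsicInterior ℝ P₁ ∧ z ∈ intrinsicInterior ℝ P₂ ∧
    Q = convexHull ℝ (P₁ ∪ P₂)

/-- Combinatorial equivalence: an inclusion-preserving bijection between face lattices. -/
def CombEquiv {N M : ℕ} (P : Set (EuclideanSpace ℝ (Fin N))) (Q : Set (EuclideanSpace ℝ (Fin M))) : Prop :=
  Nonempty ({F : Set (EuclideanSpace ℝ (Fin N)) // IsFace P F} ≃o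
    {G : Set (EuclideanSpace ℝ (Fin M)) // IsFace Q G})

/-- `P` is combinatorially dual to `Q`: its face lattice is that of `Q` reversed. -/
def DualCombEquiv {N M : ℕ} (P : Set (EuclideanSpace ℝ (Fin N))) (Q : Set (EuclideanSpace ℝ (Fin M))) : Prop :=
  Nonempty ({F : Set (EuclideanSpace ℝ (Fin N)) // IsFace P F} ≃o
    ({G : Set (EuclideanSpace ℝ (Fin M)) // IsFace Q G})ᵒᵈ)

/-- `P` (of dimension `d`) is simplicial: all its facets are simplices. -/
def IsSimplicial {N : ℕ} (P : Set (EuclideanSpace ℝ (Fin N))) (d : ℕ) : Prop :=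
  ∀ F, IsFace P F → F.Nonempty → pdim F = d - 1 → IsSimplex F (d - 1)

/-- The combinatorial data of the face lattice of a polytope: faces are recorded by their vertex
sets, and `rank` is the dimension plus one. -/
structure FaceSystem (α : Type*) [DecidableEq α] where
  faces : Finset (Finset α)
  rank : Finset α → ℕ
  rank_empty : rank ∅ = 0
  empty_mem : ∅ ∈ faces
  singleton_mem : ∀ F ∈ faces, ∀ v ∈ F, {v} ∈ faces
  rank_singleton : ∀ v, {v} ∈ faces → rank {v} = 1
  inter_mem : ∀ F ∈ faces, ∀ G ∈ faces, F ∩ G ∈ faces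
  rank_lt : ∀ F ∈ faces, ∀ G ∈ faces, F ⊂ G → rank F < rank G
  exists_coatom : ∀ F ∈ faces, ∀ G ∈ faces, F ⊆ G → ∀ x ∈ G, x ∉ F →
    ∃ H ∈ faces, F ⊆ H ∧ H ⊆ G ∧ x ∉ H ∧ rank H + 1 = rank G
  card_of_rank_two : ∀ F ∈ faces, rank F = 2 → F.card = 2

namespace FaceSystem

variable {α : Type*} [DecidableEq α] (L : FaceSystem α)

/-- The faces of rank `j` between `F` and `G`. -/
def interval (F G : Finset α) (j : ℕ) : Finset (Finset α) :=
  {H ∈ L.faces | F ⊆ H ∧ H ⊆ G ∧ L.rank H = j}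

variable {L} {F G H : Finset α}

lemma mem_interval {j : ℕ} :
    H ∈ L.interval F G j ↔ H ∈ L.faces ∧ F ⊆ H ∧ H ⊆ G ∧ L.rank H = j := by
  simp [interval]

lemma rank_mono (hF : F ∈ L.faces) (hG : G ∈ L.faces) (h : F ⊆ G) : L.rank F ≤ L.rank G := by
  rcases h.eq_or_ssubset with rfl | h
  · rfl
  · exact (L.rank_lt F hF G hG h).le

lemma eq_of_rank_le (hF : F ∈ L.faces) (hG : G ∈ L.faces) (h : F ⊆ G)
    (hr : L.rank G ≤ L.rank F) : F = G := by
  rcases h.eq_or_ssubset with rfl | h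
  · rfl
  · exact absurd (L.rank_lt F hF G hG h) (by omega)

lemma exists_rank_eq (hF : F ∈ L.faces) (hG : G ∈ L.faces) (h : F ⊆ G) {j : ℕ}
    (h1 : L.rank F ≤ j) (h2 : j ≤ L.rank G) :
    ∃ H ∈ L.faces, F ⊆ H ∧ H ⊆ G ∧ L.rank H = j := by
  obtain ⟨n, hn⟩ := Nat.exists_eq_add_of_le h2
  induction n generalizing G with
  | zero => exact ⟨G, hG, h, subset_rfl, by omega⟩
  | succ n ih =>
    have hne : F ⊂ G := h.ssubset_of_ne (by rintro rfl; omega)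
    obtain ⟨x, hxG, hxF⟩ := Finset.exists_of_ssubset hne
    obtain ⟨H, hH, hFH, hHG, -, hr⟩ := L.exists_coatom F hF G hG h x hxG hxF
    obtain ⟨K, hK, h3, h4, h5⟩ := ih hH hFH (by omega) (by omega)
    exact ⟨K, hK, h3, h4.trans hHG, h5⟩

/-- Intervals of a face system are atomistic. -/
lemma exists_atom (hF : F ∈ L.faces) (hG : G ∈ L.faces) (hH : H ∈ L.faces) (hFH : F ⊆ H)
    (hHG : H ⊂ G) : ∃ a ∈ L.faces, F ⊆ a ∧ a ⊆ G ∧ L.rank a = L.rank F + 1 ∧ ¬ a ⊆ H := by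
  obtain ⟨n, hn⟩ : ∃ n, L.rank H = L.rank F + n :=
    Nat.exists_eq_add_of_le (rank_mono hF hH hFH)
  have hlt := L.rank_lt H hH G hG hHG
  induction n generalizing F with
  | zero =>
    obtain rfl := eq_of_rank_le hF hH hFH (by omega)
    obtain ⟨a, ha, h1, h2, h3⟩ := exists_rank_eq hF hG hHG.subset (j := L.rank F + 1)
      (by omega) (by omega)
    exact ⟨a, ha, h1, h2, h3, fun h => by have := rank_mono ha hH h; omega⟩
  | succ n ih =>
    obtain ⟨b, hb, hFb, hbH, hrb⟩ := exists_rank_eq hF hH hFH (j := L.rank F + 1)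
      (by omega) (by omega)
    obtain ⟨c, hc, hbc, hcG, hrc, hcH⟩ := ih hb hbH (by omega)
    have hss : F ⊂ b := hFb.ssubset_of_ne (by rintro rfl; omega)
    obtain ⟨y, hyb, hyF⟩ := Finset.exists_of_ssubset hss
    obtain ⟨a, ha, hFa, hac, hya, hra⟩ := L.exists_coatom F hF c hc (hFb.trans hbc) y (hbc hyb) hyF
    refine ⟨a, ha, hFa, hac.trans hcG, by omega, fun haH => hya ?_⟩
    have hcH' := L.inter_mem c hc H hH
    have h1 : c ∩ H ⊂ c := Finset.inter_subset_left.ssubset_of_ne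
      (fun h => hcH (Finset.inter_eq_left.1 h))
    have h2 := L.rank_lt _ hcH' c hc h1
    have h3 : a = c ∩ H := eq_of_rank_le ha hcH' (Finset.subset_inter hac haH) (by omega)
    rw [h3]
    exact Finset.mem_inter.2 ⟨hbc hyb, hbH hyb⟩

lemma exists_rank_eq_not_subset (hF : F ∈ L.faces) (hG : G ∈ L.faces) (hH : H ∈ L.faces)
    (hFH : F ⊆ H) (hHG : H ⊂ G) {j : ℕ} (h1 : L.rank F + 1 ≤ j) (h2 : j ≤ L.rank G) :
    ∃ K ∈ L.faces, F ⊆ K ∧ K ⊆ G ∧ L.rank K = j ∧ ¬ K ⊆ H := by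
  obtain ⟨a, ha, hFa, haG, hra, haH⟩ := exists_atom hF hG hH hFH hHG
  obtain ⟨K, hK, haK, hKG, hrK⟩ := exists_rank_eq ha hG haG (hra.trans_le h1) h2
  exact ⟨K, hK, hFa.trans haK, hKG, hrK, fun h => haH (haK.trans h)⟩

lemma interval_disjoint_union_subset {a h : Finset α} {j : ℕ} (hFa : F ⊆ a)
    (hhG : h ⊆ G) (hah : ¬ a ⊆ h) :
    Disjoint (L.interval F h j) (L.interval a G j) ∧
      L.interval F h j ∪ L.interval a G j ⊆ L.interval F G j := by
  constructor
  · rw [Finset.disjoint_left]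
    intro K h1 h2
    rw [mem_interval] at h1 h2
    exact hah (h2.2.1.trans h1.2.2.1)
  · intro K hK
    rw [Finset.mem_union, mem_interval, mem_interval] at hK
    rw [mem_interval]
    rcases hK with ⟨h1, h2, h3, h4⟩ | ⟨h1, h2, h3, h4⟩
    · exact ⟨h1, h2, h3.trans hhG, h4⟩
    · exact ⟨h1, hFa.trans h2, h3, h4⟩

/-- An interval of length `n` has at least as many elements of each rank as a Boolean lattice. -/
lemma choose_le_card_interval (hF : F ∈ L.faces) (hG : G ∈ L.faces) (hFG : F ⊆ G) (i : ℕ) :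
    (L.rank G - L.rank F).choose i ≤ (L.interval F G (L.rank F + i)).card := by
  obtain ⟨n, hn⟩ : ∃ n, L.rank G = L.rank F + n :=
    Nat.exists_eq_add_of_le (rank_mono hF hG hFG)
  induction n generalizing F G i with
  | zero =>
    have : L.rank G - L.rank F = 0 := by omega
    rw [this]
    cases i with
    | zero =>
      simp only [Nat.choose_self, add_zero]
      exact Finset.card_pos.2 ⟨F, mem_interval.2 ⟨hF, subset_rfl, hFG, rfl⟩⟩
    | succ i => simp
  | succ n ih =>
    obtain ⟨a, ha, hFa, haG, hra⟩ := exists_rank_eq hF hG hFG (j := L.rank F + 1)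
      (by omega) (by omega)
    have hss : F ⊂ a := hFa.ssubset_of_ne (by rintro rfl; omega)
    obtain ⟨x, hxa, hxF⟩ := Finset.exists_of_ssubset hss
    obtain ⟨h, hh, hFh, hhG, hxh, hrh⟩ := L.exists_coatom F hF G hG hFG x (haG hxa) hxF
    obtain ⟨hd, hu⟩ := interval_disjoint_union_subset (L := L) (j := L.rank F + i) hFa hhG
      (fun h' => hxh (h' hxa))
    have hcard := Finset.card_le_card hu
    rw [Finset.card_union_of_disjoint hd] at hcard
    have h1 := ih hF hh hFh i (by omega)
    have e1 : L.rank G - L.rank F = n + 1 := by omega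
    have e2 : L.rank h - L.rank F = n := by omega
    rw [e2] at h1
    rw [e1]
    cases i with
    | zero => rw [Nat.choose_zero_right] at h1 ⊢; omega
    | succ i =>
      have h2 := ih ha hG haG i (by omega)
      have e3 : L.rank G - L.rank a = n := by omega
      have e4 : L.rank a + i = L.rank F + (i + 1) := by omega
      rw [e3, e4] at h2
      rw [Nat.choose_succ_succ']
      omega

/-- If an interval has as few elements of some intermediate rank as a Boolean lattice, then every
atom is avoided by only one coatom. -/
lemma coatom_unique_of_card_eq (hF : F ∈ L.faces) (hG : G ∈ L.faces) {i : ℕ} (hi1 : 1 ≤ i)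
    (hi2 : L.rank F + i < L.rank G)
    (hc : (L.interval F G (L.rank F + i)).card ≤ (L.rank G - L.rank F).choose i)
    {a h h' : Finset α} (ha : a ∈ L.faces) (hFa : F ⊆ a) (haG : a ⊆ G)
    (hra : L.rank a = L.rank F + 1)
    (hh : h ∈ L.interval F G (L.rank G - 1)) (hh' : h' ∈ L.interval F G (L.rank G - 1))
    (hah : ¬ a ⊆ h) (hah' : ¬ a ⊆ h') : h = h' := by
  obtain ⟨i, rfl⟩ := Nat.exists_eq_add_of_le' hi1
  have key : ∀ g ∈ L.interval F G (L.rank G - 1), ¬ a ⊆ g →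
      ∀ K ∈ L.interval F G (L.rank F + (i + 1)), K ⊆ g ∨ a ⊆ K := by
    intro g hg hag K hK
    by_contra hcon
    rw [not_or] at hcon
    rw [mem_interval] at hg
    obtain ⟨hd, hu⟩ := interval_disjoint_union_subset (L := L) (j := L.rank F + (i + 1)) hFa
      hg.2.2.1 hag
    have hss : L.interval F g (L.rank F + (i + 1)) ∪ L.interval a G (L.rank F + (i + 1)) ⊂
        L.interval F G (L.rank F + (i + 1)) := by
      refine Finset.ssubset_iff_of_subset hu |>.2 ⟨K, hK, ?_⟩
      rw [Finset.mem_union, mem_interval, mem_interval]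
      tauto
    have hlt := Finset.card_lt_card hss
    rw [Finset.card_union_of_disjoint hd] at hlt
    have h1 := choose_le_card_interval hF hg.1 hg.2.1 (i + 1)
    have h2 := choose_le_card_interval ha hG haG i
    have e4 : L.rank a + i = L.rank F + (i + 1) := by omega
    obtain ⟨n, hn⟩ : ∃ n, L.rank G = L.rank F + n + 1 := ⟨L.rank G - L.rank F - 1, by omega⟩
    have e1 : L.rank G - L.rank F = n + 1 := by omega
    have e2 : L.rank g - L.rank F = n := by omega
    have e3 : L.rank G - L.rank a = n := by omega
    rw [e2] at h1
    rw [e3, e4] at h2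
    rw [e1, Nat.choose_succ_succ'] at hc
    omega
  have k1 := key h' hh' hah'
  rw [mem_interval] at hh hh'
  by_contra hne
  have hm := L.inter_mem h hh.1 h' hh'.1
  have hlt : h ∩ h' ⊂ h := Finset.inter_subset_left.ssubset_of_ne (fun e =>
    hne (eq_of_rank_le hh.1 hh'.1 (Finset.inter_eq_left.1 e) (by omega)))
  obtain ⟨K, hK, hFK, hKh, hrK, hKm⟩ := exists_rank_eq_not_subset hF hh.1 hm
    (Finset.subset_inter hh.2.1 hh'.2.1) hlt (j := L.rank F + (i + 1)) (by omega) (by omega)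
  rcases k1 K (mem_interval.2 ⟨hK, hFK, hKh.trans hh.2.2.1, hrK⟩) with h1 | h1
  · exact hKm (Finset.subset_inter hKh h1)
  · exact hah (h1.trans hKh)

variable (L) in
/-- The vertex `v` of `G` is simple: it lies on exactly `dim G` facets, and any facet `h` through
`v` leaves out the other endpoint `y` of the edge in which the remaining ones meet. -/
structure IsSimpleAt (G : Finset α) (v : α) : Prop where
  card_eq : (L.interval {v} G (L.rank G - 1)).card = L.rank G - 1
  exists_neighbor : ∀ h ∈ L.interval {v} G (L.rank G - 1), ∃ y ∈ G, y ≠ v ∧ y ∉ h ∧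
    (∀ h' ∈ L.interval {v} G (L.rank G - 1), h' ≠ h → y ∈ h') ∧
    ∀ z ∈ G, (∀ h' ∈ L.interval {v} G (L.rank G - 1), h' ≠ h → z ∈ h') → z = v ∨ z = y

lemma isSimpleAt_of_card_eq (hG : G ∈ L.faces) {v : α} (hv : v ∈ G) {i : ℕ} (hi1 : 1 ≤ i)
    (hi2 : 1 + i < L.rank G)
    (hc : (L.interval {v} G (1 + i)).card ≤ (L.rank G - 1).choose i) : L.IsSimpleAt G v := by
  have hF : {v} ∈ L.faces := L.singleton_mem G hG v hv
  have hr := L.rank_singleton v hF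
  have hvG : {v} ⊆ G := Finset.singleton_subset_iff.2 hv
  set F : Finset α := {v} with hFdef
  have huniq : ∀ a h h' : Finset α, a ∈ L.faces → F ⊆ a → a ⊆ G → L.rank a = L.rank F + 1 →
      h ∈ L.interval F G (L.rank G - 1) → h' ∈ L.interval F G (L.rank G - 1) →
      ¬ a ⊆ h → ¬ a ⊆ h' → h = h' := fun a h h' h1 h2 h3 h4 h5 h6 h7 h8 =>
    coatom_unique_of_card_eq hF hG hi1 (by omega) (by rwa [hr]) h1 h2 h3 h4 h5 h6 h7 h8
  have hatom : ∀ h ∈ L.interval F G (L.rank G - 1), ∃ a ∈ L.faces, F ⊆ a ∧ a ⊆ G ∧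
      L.rank a = L.rank F + 1 ∧ ¬ a ⊆ h ∧
      ∀ h' ∈ L.interval F G (L.rank G - 1), h' ≠ h → a ⊆ h' := by
    intro h hh
    have hh' := mem_interval.1 hh
    obtain ⟨a, ha, h1, h2, h3, h4⟩ := exists_atom hF hG hh'.1 hh'.2.1
      (hh'.2.2.1.ssubset_of_ne (by rintro rfl; omega))
    refine ⟨a, ha, h1, h2, h3, h4, fun g hg hne => ?_⟩
    by_contra hag
    exact hne (huniq a g h ha h1 h2 h3 hg hh hag h4)
  have hinter : ∀ T ⊆ L.interval F G (L.rank G - 1), ∃ K ∈ L.faces, F ⊆ K ∧ K ⊆ G ∧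
      (∀ z ∈ G, z ∈ K ↔ ∀ h ∈ T, z ∈ h) ∧ L.rank K + T.card ≤ L.rank G := by
    intro T
    induction T using Finset.induction_on with
    | empty => exact fun _ => ⟨G, hG, hvG, subset_rfl, by simp, by simp⟩
    | insert h T hhT ih =>
      intro hT
      obtain ⟨K, hK, hFK, hKG, hKT, hrK⟩ := ih ((Finset.subset_insert _ _).trans hT)
      have hh := hT (Finset.mem_insert_self h T)
      have hh' := mem_interval.1 hh
      obtain ⟨a, ha, h1, h2, h3, h4, h5⟩ := hatom h hh
      have haK : a ⊆ K := fun z hz => (hKT z (h2 hz)).2 fun g hg =>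
        h5 g (hT (Finset.mem_insert_of_mem hg)) (by rintro rfl; exact hhT hg) hz
      have hlt := L.rank_lt _ (L.inter_mem K hK h hh'.1) K hK
        (Finset.inter_subset_left.ssubset_of_ne
          fun e => h4 (haK.trans (Finset.inter_eq_left.1 e)))
      refine ⟨K ∩ h, L.inter_mem K hK h hh'.1, Finset.subset_inter hFK hh'.2.1,
        Finset.inter_subset_left.trans hKG, ?_, ?_⟩
      · intro z hz
        rw [Finset.mem_inter, hKT z hz, Finset.forall_mem_insert, and_comm]
      · rw [Finset.card_insert_of_notMem hhT]
        omega
  have hcard : (L.interval F G (L.rank G - 1)).card = L.rank G - 1 := by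
    obtain ⟨K, hK, hFK, -, -, hrK⟩ := hinter _ subset_rfl
    have h1 := rank_mono hF hK hFK
    have h2 := choose_le_card_interval hF hG hvG (L.rank G - 2)
    have e1 : L.rank F + (L.rank G - 2) = L.rank G - 1 := by omega
    have e2 : L.rank G - L.rank F = (L.rank G - 2) + 1 := by omega
    rw [e1, e2, Nat.choose_succ_self_right] at h2
    omega
  refine ⟨hcard, fun h hh => ?_⟩
  obtain ⟨a, ha, h1, h2, h3, h4, h5⟩ := hatom h hh
  obtain ⟨K, hK, hFK, hKG, hKT, hrK⟩ := hinter _ (Finset.erase_subset h _)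
  have haK : a ⊆ K := fun z hz => (hKT z (h2 hz)).2 fun g hg =>
    h5 g (Finset.mem_of_mem_erase hg) (Finset.ne_of_mem_erase hg) hz
  rw [Finset.card_erase_of_mem hh, hcard] at hrK
  obtain rfl := eq_of_rank_le ha hK haK (by omega)
  have hva : v ∈ a := h1 (Finset.mem_singleton_self v)
  obtain ⟨y, hy⟩ := Finset.card_eq_one.1 (show (a.erase v).card = 1 by
    rw [Finset.card_erase_of_mem hva, L.card_of_rank_two a ha (by omega)])
  have hya : y ∈ a.erase v := hy ▸ Finset.mem_singleton_self y
  have hay : ∀ z ∈ a, z = v ∨ z = y := fun z hz => by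
    by_cases hzv : z = v
    · exact Or.inl hzv
    · exact Or.inr (Finset.mem_singleton.1 (hy ▸ Finset.mem_erase.2 ⟨hzv, hz⟩))
  have hvh : v ∈ h := (mem_interval.1 hh).2.1 (Finset.mem_singleton_self v)
  refine ⟨y, h2 (Finset.mem_of_mem_erase hya), Finset.ne_of_mem_erase hya, fun hyh => h4 ?_,
    fun g hg hne => h5 g hg hne (Finset.mem_of_mem_erase hya), fun z hz hzT => hay z ?_⟩
  · intro z hz
    rcases hay z hz with rfl | rfl <;> assumption
  · exact (hKT z hz).2 fun g hg => hzT g (Finset.mem_of_mem_erase hg) (Finset.ne_of_mem_erase hg)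

variable (L) in
/-- The faces of `G` of rank `j` that meet `U`. -/
def meeting (G U : Finset α) (j : ℕ) : Finset (Finset α) :=
  {H ∈ L.interval ∅ G j | ¬ Disjoint H U}

lemma exists_disjoint_face (hG : G ∈ L.faces) {v : α} (hv : v ∈ G) (U : Finset α) (hvU : v ∉ U)
    (hU : U.card + 1 ≤ L.rank G) :
    ∃ H ∈ L.faces, v ∈ H ∧ H ⊆ G ∧ Disjoint H U ∧ L.rank H + U.card = L.rank G := by
  induction U using Finset.induction_on with
  | empty => exact ⟨G, hG, hv, subset_rfl, by simp, by simp⟩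
  | insert w U hwU ih =>
    rw [Finset.card_insert_of_notMem hwU] at hU ⊢
    rw [Finset.mem_insert, not_or] at hvU
    obtain ⟨H, hH, hvH, hHG, hd, hr⟩ := ih hvU.2 (by omega)
    have hF : {v} ∈ L.faces := L.singleton_mem G hG v hv
    have hrF := L.rank_singleton v hF
    have hvH' : {v} ⊆ H := Finset.singleton_subset_iff.2 hvH
    obtain ⟨K, hK, hvK, hKH, hwK, hrK⟩ : ∃ K ∈ L.faces, {v} ⊆ K ∧ K ⊆ H ∧ w ∉ K ∧
        L.rank K + 1 = L.rank H := by
      by_cases hw : w ∈ H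
      · exact L.exists_coatom _ hF H hH hvH' w hw (by simpa using Ne.symm hvU.1)
      · obtain ⟨K, hK, h1, h2, h3⟩ := exists_rank_eq hF hH hvH' (j := L.rank H - 1)
          (by omega) (by omega)
        exact ⟨K, hK, h1, h2, fun h => hw (h2 h), by omega⟩
    refine ⟨K, hK, Finset.singleton_subset_iff.1 hvK, hKH.trans hHG, ?_, by omega⟩
    rw [Finset.disjoint_insert_right]
    exact ⟨hwK, hd.mono_left hKH⟩

lemma choose_add_card_meeting_le (hG : G ∈ L.faces) {v : α} (hv : v ∈ G) (U : Finset α)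
    (hvU : v ∉ U) (hU : U.card + 1 ≤ L.rank G) (k : ℕ) :
    (L.rank G - 1 - U.card).choose k + (L.meeting G U (k + 1)).card ≤
      (L.meeting G (insert v U) (k + 1)).card := by
  obtain ⟨H, hH, hvH, hHG, hd, hr⟩ := exists_disjoint_face hG hv U hvU hU
  have hF : {v} ∈ L.faces := L.singleton_mem G hG v hv
  have hrF := L.rank_singleton v hF
  have h1 := choose_le_card_interval hF hH (Finset.singleton_subset_iff.2 hvH) k
  rw [show L.rank H - L.rank {v} = L.rank G - 1 - U.card by omega,
    show L.rank {v} + k = k + 1 by omega] at h1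
  have hdis : Disjoint (L.interval {v} H (k + 1)) (L.meeting G U (k + 1)) := by
    rw [Finset.disjoint_left]
    intro K h1 h2
    rw [mem_interval] at h1
    exact (Finset.mem_filter.1 h2).2 (hd.mono_left h1.2.2.1)
  have hsub : L.interval {v} H (k + 1) ∪ L.meeting G U (k + 1) ⊆
      L.meeting G (insert v U) (k + 1) := by
    intro K hK
    rw [Finset.mem_union] at hK
    unfold meeting at hK ⊢
    rw [Finset.mem_filter] at hK ⊢
    rw [Finset.disjoint_insert_right]
    rcases hK with hK | hK
    · rw [mem_interval] at hK ⊢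
      exact ⟨⟨hK.1, by simp, hK.2.2.1.trans hHG, hK.2.2.2⟩,
        fun h => h.1 (hK.2.1 (Finset.mem_singleton_self v))⟩
    · exact ⟨hK.1, fun h => hK.2 h.2⟩
  have h3 := Finset.card_le_card hsub
  rw [Finset.card_union_of_disjoint hdis] at h3
  omega

lemma sum_choose_add_card_meeting_le (hG : G ∈ L.faces) (W U : Finset α) (hW : W ⊆ G)
    (hWU : Disjoint W U) (hU : W.card + U.card ≤ L.rank G) (k : ℕ) :
    ∑ i ∈ Finset.range W.card, (L.rank G - 1 - (U.card + i)).choose k +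
      (L.meeting G U (k + 1)).card ≤ (L.meeting G (W ∪ U) (k + 1)).card := by
  induction W using Finset.induction_on with
  | empty => simp
  | insert w W hwW ih =>
    rw [Finset.card_insert_of_notMem hwW] at hU ⊢
    rw [Finset.disjoint_insert_left] at hWU
    rw [Finset.insert_subset_iff] at hW
    have h1 := ih hW.2 hWU.2 (by omega)
    have h2 := choose_add_card_meeting_le hG hW.1 (W ∪ U) (by simp [hwW, hWU.1])
      (by rw [Finset.card_union_of_disjoint hWU.2]; omega) k
    rw [Finset.card_union_of_disjoint hWU.2, add_comm W.card] at h2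
    rw [Finset.sum_range_succ, Finset.insert_union]
    omega

lemma sum_choose_le_card_meeting (hG : G ∈ L.faces) (W : Finset α) (hW : W ⊆ G)
    (hc : W.card ≤ L.rank G) (k : ℕ) :
    ∑ i ∈ Finset.range W.card, (L.rank G - 1 - i).choose k ≤ (L.meeting G W (k + 1)).card := by
  have := sum_choose_add_card_meeting_le hG W ∅ hW (by simp) (by simpa using hc) k
  simp only [Finset.card_empty, zero_add, Finset.union_empty] at this
  omega

lemma meeting_singleton (v : α) (j : ℕ) : L.meeting G {v} j = L.interval {v} G j := by
  ext K
  simp only [meeting, Finset.mem_filter, mem_interval, Finset.disjoint_singleton_right,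
    Finset.singleton_subset_iff, not_not, Finset.empty_subset, true_and]
  tauto

lemma card_meeting_singleton_le (hG : G ∈ L.faces) {W : Finset α} (hW : W ⊆ G)
    (hc : W.card ≤ L.rank G) {k : ℕ}
    (ht : (L.meeting G W (k + 1)).card ≤
      ∑ i ∈ Finset.range W.card, (L.rank G - 1 - i).choose k) {v : α} (hv : v ∈ W) :
    (L.meeting G {v} (k + 1)).card ≤ (L.rank G - 1).choose k := by
  have h := sum_choose_add_card_meeting_le hG (W.erase v) {v} ((Finset.erase_subset _ _).trans hW)
    (by simp) (by rw [Finset.card_erase_of_mem hv, Finset.card_singleton]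
                  have := Finset.card_pos.2 ⟨v, hv⟩; omega) k
  rw [Finset.union_comm, Finset.singleton_union, Finset.insert_erase hv] at h
  have hcard := Finset.card_erase_add_one hv
  rw [← hcard, Finset.sum_range_succ'] at ht
  simp only [Finset.card_singleton, Nat.add_comm 1, Nat.sub_zero] at h ht
  omega

lemma card_meeting_pair_le (hG : G ∈ L.faces) {W : Finset α} (hW : W ⊆ G)
    (hc : W.card ≤ L.rank G) {k : ℕ}
    (ht : (L.meeting G W (k + 1)).card ≤
      ∑ i ∈ Finset.range W.card, (L.rank G - 1 - i).choose k) {u v : α} (hu : u ∈ W) (hv : v ∈ W)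
    (huv : u ≠ v) :
    (L.meeting G {u, v} (k + 1)).card ≤
      (L.rank G - 1).choose k + (L.rank G - 1 - 1).choose k := by
  have hv' : v ∈ W.erase u := Finset.mem_erase.2 ⟨huv.symm, hv⟩
  have hcard := Finset.card_erase_add_one hu
  have hcard' := Finset.card_erase_add_one hv'
  have h := sum_choose_add_card_meeting_le hG ((W.erase u).erase v) {u, v}
    (((Finset.erase_subset _ _).trans (Finset.erase_subset _ _)).trans hW)
    (by simp) (by rw [Finset.card_pair huv]; omega) k
  have e : (W.erase u).erase v ∪ {u, v} = W := by
    ext z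
    simp only [Finset.mem_union, Finset.mem_erase, Finset.mem_insert, Finset.mem_singleton]
    by_cases h1 : z = u <;> by_cases h2 : z = v <;> simp_all
  rw [e, Finset.card_pair huv] at h
  rw [← hcard, ← hcard', Finset.sum_range_succ', Finset.sum_range_succ'] at ht
  have e2 : ∀ i, i + 1 + 1 = 2 + i := fun i => by ring
  simp only [Nat.sub_zero, e2, zero_add] at ht
  omega

lemma isSimpleAt_of_tight (hG : G ∈ L.faces) {W : Finset α} (hW : W ⊆ G)
    (hc : W.card ≤ L.rank G) {k : ℕ} (hk1 : 1 ≤ k) (hk2 : k + 2 ≤ L.rank G)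
    (ht : (L.meeting G W (k + 1)).card ≤
      ∑ i ∈ Finset.range W.card, (L.rank G - 1 - i).choose k) {v : α} (hv : v ∈ W) :
    L.IsSimpleAt G v := by
  have h := card_meeting_singleton_le hG hW hc ht hv
  rw [meeting_singleton, add_comm] at h
  exact isSimpleAt_of_card_eq hG (hW hv) hk1 (by omega) h

lemma facet_unique_of_tight (hG : G ∈ L.faces) {W : Finset α} (hW : W ⊆ G)
    (hc : W.card ≤ L.rank G) {k : ℕ} (hk1 : 1 ≤ k) (hk2 : k + 2 ≤ L.rank G)
    (ht : (L.meeting G W (k + 1)).card ≤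
      ∑ i ∈ Finset.range W.card, (L.rank G - 1 - i).choose k) {u v : α} (hu : u ∈ W) (hv : v ∈ W)
    (huv : u ≠ v) {h h' : Finset α} (hh : h ∈ L.interval {v} G (L.rank G - 1))
    (hh' : h' ∈ L.interval {v} G (L.rank G - 1)) (huh : u ∉ h) (huh' : u ∉ h') : h = h' := by
  have hF := L.singleton_mem G hG v (hW hv)
  have hF' := L.singleton_mem G hG u (hW hu)
  have hr := L.rank_singleton v hF
  have hr' := L.rank_singleton u hF'
  rw [mem_interval] at hh hh'
  by_contra hne
  have hm := L.inter_mem h hh.1 h' hh'.1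
  have hlt : h ∩ h' ⊂ h := Finset.inter_subset_left.ssubset_of_ne (fun e =>
    hne (eq_of_rank_le hh.1 hh'.1 (Finset.inter_eq_left.1 e) (by omega)))
  obtain ⟨K, hK, hFK, hKh, hrK, hKm⟩ := exists_rank_eq_not_subset hF hh.1 hm
    (Finset.subset_inter hh.2.1 hh'.2.1) hlt (j := k + 1) (by omega) (by omega)
  have h1 := choose_le_card_interval hF hh'.1 hh'.2.1 k
  have h2 := choose_le_card_interval hF' hG (Finset.singleton_subset_iff.2 (hW hu)) k
  have hp := card_meeting_pair_le hG hW hc ht hu hv huv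
  rw [show L.rank h' - L.rank {v} = L.rank G - 1 - 1 by omega,
    show L.rank {v} + k = k + 1 by omega] at h1
  rw [hr', add_comm 1 k] at h2
  have hd1 : Disjoint (L.interval {v} h' (k + 1)) (L.interval {u} G (k + 1)) := by
    rw [Finset.disjoint_left]
    intro A hA hB
    rw [mem_interval] at hA hB
    exact huh' (hA.2.2.1 (hB.2.1 (Finset.mem_singleton_self u)))
  have hd2 : K ∉ L.interval {v} h' (k + 1) ∪ L.interval {u} G (k + 1) := by
    rw [Finset.mem_union, mem_interval, mem_interval]
    rintro (hA | hB)
    · exact hKm (Finset.subset_inter hKh hA.2.2.1)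
    · exact huh (hKh (hB.2.1 (Finset.mem_singleton_self u)))
  have hsub : insert K (L.interval {v} h' (k + 1) ∪ L.interval {u} G (k + 1)) ⊆
      L.meeting G {u, v} (k + 1) := by
    intro A hA
    simp only [Finset.mem_insert, Finset.mem_union, mem_interval, meeting, Finset.mem_filter,
      Finset.disjoint_insert_right, Finset.disjoint_singleton_right, Finset.empty_subset, true_and,
      Finset.singleton_subset_iff] at hA ⊢
    rcases hA with rfl | hA | hA
    · exact ⟨⟨hK, hKh.trans hh.2.2.1, hrK⟩,
        fun hx => hx.2 (hFK (Finset.mem_singleton_self v))⟩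
    · exact ⟨⟨hA.1, hA.2.2.1.trans hh'.2.2.1, hA.2.2.2⟩, fun hx => hx.2 hA.2.1⟩
    · exact ⟨⟨hA.1, hA.2.2⟩, fun hx => hx.1 hA.2.1⟩
  have hcard := Finset.card_le_card hsub
  rw [Finset.card_insert_of_notMem hd2, Finset.card_union_of_disjoint hd1] at hcard
  omega

lemma rank_le_card (hG : G ∈ L.faces) : L.rank G ≤ G.card := by
  induction hn : L.rank G generalizing G with
  | zero => omega
  | succ n ih =>
    have hne : G.Nonempty := by
      rw [Finset.nonempty_iff_ne_empty]
      rintro rfl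
      rw [L.rank_empty] at hn
      omega
    obtain ⟨x, hx⟩ := hne
    obtain ⟨H, hH, -, hHG, hxH, hr⟩ := L.exists_coatom ∅ L.empty_mem G hG (by simp) x hx (by simp)
    have h1 := ih hH (by omega)
    have h2 := Finset.card_lt_card (hHG.ssubset_of_ne (by rintro rfl; exact hxH hx))
    omega

/-- A polytope that is not a simplex has a facet that misses at least two vertices. -/
lemma exists_coatom_card_add_two_le (hG : G ∈ L.faces) (hc : L.rank G < G.card) :
    ∃ F ∈ L.faces, F ⊆ G ∧ L.rank F + 1 = L.rank G ∧ F.card + 2 ≤ G.card := by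
  by_contra! hcon
  have herase : ∀ x ∈ G, G.erase x ∈ L.faces := by
    intro x hx
    obtain ⟨H, hH, -, hHG, hxH, hr⟩ := L.exists_coatom ∅ L.empty_mem G hG (by simp) x hx (by simp)
    have h1 := hcon H hH hHG hr
    have h2 : H ⊆ G.erase x := Finset.subset_erase.2 ⟨hHG, hxH⟩
    have h3 : H = G.erase x := Finset.eq_of_subset_of_card_le h2
      (by have := Finset.card_erase_add_one hx; omega)
    rwa [← h3]
  have key : ∀ T ⊆ G, G \ T ∈ L.faces ∧ L.rank (G \ T) + T.card ≤ L.rank G := by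
    intro T
    induction T using Finset.induction_on with
    | empty => simp [hG]
    | insert x T hx ih =>
      intro hT
      rw [Finset.insert_subset_iff] at hT
      obtain ⟨h1, h2⟩ := ih hT.2
      have e : G \ insert x T = (G \ T) ∩ G.erase x := by
        ext z
        simp only [Finset.mem_sdiff, Finset.mem_insert, Finset.mem_inter, Finset.mem_erase]
        tauto
      have h3 : G \ insert x T ∈ L.faces := e ▸ L.inter_mem _ h1 _ (herase x hT.1)
      have h4 := L.rank_lt _ h3 _ h1 (Finset.ssubset_iff_of_subset
        (Finset.sdiff_subset_sdiff subset_rfl (Finset.subset_insert _ _)) |>.2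
        ⟨x, by simp [hT.1, hx], by simp⟩)
      rw [Finset.card_insert_of_notMem hx]
      exact ⟨h3, by omega⟩
  have := (key G subset_rfl).2
  omega

lemma card_interval_add_card_meeting_le (hFG : F ⊆ G) (j : ℕ) :
    (L.interval ∅ F j).card + (L.meeting G (G \ F) j).card ≤ (L.interval ∅ G j).card := by
  have hd : Disjoint (L.interval ∅ F j) (L.meeting G (G \ F) j) := by
    rw [Finset.disjoint_left]
    intro K h1 h2
    rw [mem_interval] at h1
    exact (Finset.mem_filter.1 h2).2
      ((Finset.disjoint_sdiff (s := F)).mono_left h1.2.2.1)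
  rw [← Finset.card_union_of_disjoint hd]
  refine Finset.card_le_card (Finset.union_subset (fun K hK => ?_) (Finset.filter_subset _ _))
  rw [mem_interval] at hK ⊢
  exact ⟨hK.1, hK.2.1, hK.2.2.1.trans hFG, hK.2.2.2⟩

end FaceSystem

lemma sum_choose_add_choose (n k m : ℕ) (hm : m ≤ n) :
    ∑ i ∈ Finset.range m, (n - 1 - i).choose k + (n - m).choose (k + 1) = n.choose (k + 1) := by
  induction m with
  | zero => simp
  | succ m ih =>
    have h := ih (by omega)
    rw [Finset.sum_range_succ, ← h]
    obtain ⟨r, hr⟩ : ∃ r, n - m = r + 1 := ⟨n - m - 1, by omega⟩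
    rw [show n - 1 - m = r by omega, show n - (m + 1) = r by omega, hr, Nat.choose_succ_succ']
    ring

lemma choose_add_choose_le {a b : ℕ} (hab : a ≤ b) (t k : ℕ) :
    (a + t).choose (k + 1) + b.choose (k + 1) ≤ a.choose (k + 1) + (b + t).choose (k + 1) := by
  induction t with
  | zero => simp
  | succ t ih =>
    rw [← add_assoc, ← add_assoc, Nat.choose_succ_succ', Nat.choose_succ_succ']
    have := Nat.choose_le_choose k (show a + t ≤ b + t by omega)
    omega

lemma choose_add_choose_lt {a b : ℕ} (hab : a < b) (t k : ℕ) (hk : 1 ≤ k) (hkt : k ≤ b + t) :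
    (a + (t + 1)).choose (k + 1) + b.choose (k + 1) <
      a.choose (k + 1) + (b + (t + 1)).choose (k + 1) := by
  have h1 := choose_add_choose_le hab.le t k
  rw [← add_assoc, ← add_assoc, Nat.choose_succ_succ', Nat.choose_succ_succ']
  have h2 : (a + t).choose k < (b + t).choose k := by
    obtain ⟨c, hc⟩ : ∃ c, b + t = c + 1 := ⟨b + t - 1, by omega⟩
    obtain ⟨k, rfl⟩ := Nat.exists_eq_add_of_le' hk
    have h3 := Nat.choose_le_choose (k + 1) (show a + t ≤ c by omega)
    rw [hc, Nat.choose_succ_succ']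
    have := Nat.choose_pos (show k ≤ c by omega)
    omega
  omega

namespace FaceSystem

variable {α : Type*} [DecidableEq α] {L : FaceSystem α} {F G H : Finset α}

/-- Grünbaum's lower bound for the number of faces of a polytope with few vertices. -/
lemma grunbaum_lower_bound (hG : G ∈ L.faces) (hc : G.card + 2 ≤ 2 * L.rank G) (k : ℕ) :
    (L.rank G).choose (k + 1) + (L.rank G - 1).choose (k + 1) ≤
      (L.interval ∅ G (k + 1)).card + (2 * L.rank G - 1 - G.card).choose (k + 1) := by
  induction hn : L.rank G generalizing G with
  | zero => omega
  | succ n ih =>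
    rw [hn] at hc
    have hrc := rank_le_card hG
    rcases hrc.eq_or_lt with hs | hs
    · have h1 := choose_le_card_interval L.empty_mem hG (by simp) (k + 1)
      rw [L.rank_empty, Nat.sub_zero, zero_add, hn] at h1
      rw [show 2 * (n + 1) - 1 - G.card = n + 1 - 1 by omega]
      omega
    · obtain ⟨F, hF, hFG, hrF, hcF⟩ := exists_coatom_card_add_two_le hG hs
      have hcF' := rank_le_card hF
      have h1 := ih hF (by omega) (by omega)
      have h2 := card_interval_add_card_meeting_le (L := L) hFG (k + 1)
      have hcd := Finset.card_sdiff_add_card_eq_card hFG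
      have h3 := sum_choose_le_card_meeting hG (G \ F) Finset.sdiff_subset (by omega) k
      have h4 := sum_choose_add_choose (L.rank G) k (G \ F).card (by omega)
      have h5 := choose_add_choose_le (a := 2 * (n + 1) - 1 - G.card)
        (b := L.rank G - (G \ F).card) (by omega) ((G \ F).card - 2) k
      rw [show 2 * (n + 1) - 1 - G.card + ((G \ F).card - 2) = 2 * n - 1 - F.card by omega,
        show L.rank G - (G \ F).card + ((G \ F).card - 2) = n - 1 by omega] at h5
      rw [hn] at h3 h4 h5
      rw [show n + 1 - 1 = n by omega]
      omega

/-- In the equality case, the vertices outside of a facet missing at least two of them lie on as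
few faces as possible, and their number is `2` or maximal. -/
lemma tight_of_grunbaum_eq (hG : G ∈ L.faces) (hc : G.card + 2 ≤ 2 * L.rank G) {k : ℕ}
    (hk1 : 1 ≤ k) (hk2 : k + 3 ≤ L.rank G)
    (heq : (L.interval ∅ G (k + 1)).card + (2 * L.rank G - 1 - G.card).choose (k + 1) ≤
      (L.rank G).choose (k + 1) + (L.rank G - 1).choose (k + 1))
    (hF : F ∈ L.faces) (hFG : F ⊆ G) (hrF : L.rank F + 1 = L.rank G)
    (hcF : 2 ≤ (G \ F).card) :
    (L.meeting G (G \ F) (k + 1)).card ≤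
      ∑ i ∈ Finset.range (G \ F).card, (L.rank G - 1 - i).choose k ∧
    ((G \ F).card = 2 ∨ F.card + 1 = L.rank G) := by
  have hcF' := rank_le_card hF
  have hcd := Finset.card_sdiff_add_card_eq_card hFG
  have h1 := grunbaum_lower_bound hF (by omega) k
  have h2 := card_interval_add_card_meeting_le (L := L) hFG (k + 1)
  have h3 := sum_choose_le_card_meeting hG (G \ F) Finset.sdiff_subset (by omega) k
  have h4 := sum_choose_add_choose (L.rank G) k (G \ F).card (by omega)
  have h5 := choose_add_choose_le (a := 2 * L.rank G - 1 - G.card)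
    (b := L.rank G - (G \ F).card) (by omega) ((G \ F).card - 2) k
  have e1 : 2 * L.rank G - 1 - G.card + ((G \ F).card - 2) = 2 * L.rank F - 1 - F.card := by omega
  have e2 : L.rank G - (G \ F).card + ((G \ F).card - 2) = L.rank F - 1 := by omega
  rw [e1, e2] at h5
  rw [show L.rank G - 1 = L.rank F by omega] at heq h3 h4 ⊢
  refine ⟨by omega, ?_⟩
  by_contra! hcon
  have h6 := choose_add_choose_lt (a := 2 * L.rank G - 1 - G.card)
    (b := L.rank G - (G \ F).card) (by omega) ((G \ F).card - 3) k hk1 (by omega)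
  rw [show (G \ F).card - 3 + 1 = (G \ F).card - 2 by omega, e1, e2] at h6
  omega

end FaceSystem

namespace FaceSystem

variable {α : Type*} [DecidableEq α] (L : FaceSystem α)

/-- The facets of `V`. -/
def facets (V : Finset α) : Finset (Finset α) := L.interval ∅ V (L.rank V - 1)

/-- The facets of `V` avoiding the vertex `x`. -/
def miss (V : Finset α) (x : α) : Finset (Finset α) := {h ∈ L.facets V | x ∉ h}

/-- The vertices over which `V` is a pyramid. -/
def apexes (V : Finset α) : Finset α := {x ∈ V | V.erase x ∈ L.facets V}

/-- The facets of `V` that miss at least two vertices. -/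
def wideFacets (V : Finset α) : Finset (Finset α) := {h ∈ L.facets V | 2 ≤ (V \ h).card}

/-- The conditions on the facets of `V` that equality in Grünbaum's lower bound imposes. -/
structure IsTight (V : Finset α) : Prop where
  mem : V ∈ L.faces
  one_lt_rank : 1 < L.rank V
  simple : ∀ F ∈ L.wideFacets V, ∀ v ∈ V \ F, L.IsSimpleAt V v
  unique : ∀ F ∈ L.wideFacets V, ∀ u ∈ V \ F, ∀ v ∈ V \ F, u ≠ v → ∀ h ∈ L.facets V,
    ∀ h' ∈ L.facets V, v ∈ h → v ∈ h' → u ∉ h → u ∉ h' → h = h'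
  card_sdiff : ∀ F ∈ L.wideFacets V, (V \ F).card = 2 ∨ F.card + 1 = L.rank V
  rank_lt_card : L.rank V < V.card

variable {L} {V : Finset α}

lemma mem_facets {h : Finset α} :
    h ∈ L.facets V ↔ h ∈ L.faces ∧ h ⊆ V ∧ L.rank h = L.rank V - 1 := by
  simp [facets, mem_interval]

lemma mem_interval_singleton {v : α} {h : Finset α} :
    h ∈ L.interval {v} V (L.rank V - 1) ↔ h ∈ L.facets V ∧ v ∈ h := by
  rw [mem_facets, mem_interval, Finset.singleton_subset_iff]
  tauto

lemma mem_miss {x : α} {h : Finset α} : h ∈ L.miss V x ↔ h ∈ L.facets V ∧ x ∉ h := by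
  simp [miss]

lemma mem_wideFacets {h : Finset α} :
    h ∈ L.wideFacets V ↔ h ∈ L.facets V ∧ 2 ≤ (V \ h).card := by
  simp [wideFacets]

lemma mem_apexes {x : α} : x ∈ L.apexes V ↔ x ∈ V ∧ V.erase x ∈ L.facets V := by
  simp [apexes]

lemma facet_eq_of_subset {h h' : Finset α} (hh : h ∈ L.facets V) (hh' : h' ∈ L.facets V)
    (hs : h ⊆ h') : h = h' := by
  rw [mem_facets] at hh hh'
  exact eq_of_rank_le hh.1 hh'.1 hs (by omega)

lemma erase_not_wide (x : α) : V.erase x ∉ L.wideFacets V := by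
  rw [mem_wideFacets]
  rintro ⟨-, h⟩
  have h1 : V \ V.erase x ⊆ {x} := by
    intro y
    simp only [Finset.mem_sdiff, Finset.mem_erase, Finset.mem_singleton]
    tauto
  have := Finset.card_le_card h1
  rw [Finset.card_singleton] at this
  omega

namespace IsTight

lemma facet_ssubset (hT : L.IsTight V) {h : Finset α} (hh : h ∈ L.facets V) : h ⊂ V := by
  rw [mem_facets] at hh
  have := hT.one_lt_rank
  exact hh.2.1.ssubset_of_ne (by rintro rfl; omega)

lemma exists_facet (hT : L.IsTight V) {F : Finset α} (hF : F ∈ L.faces) (hFV : F ⊆ V) {x : α}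
    (hx : x ∈ V) (hxF : x ∉ F) : ∃ h ∈ L.facets V, F ⊆ h ∧ x ∉ h := by
  obtain ⟨H, hH, h1, h2, h3, h4⟩ := L.exists_coatom F hF V hT.mem hFV x hx hxF
  exact ⟨H, mem_facets.2 ⟨hH, h2, by omega⟩, h1, h3⟩

lemma exists_facet_of_ne (hT : L.IsTight V) {x y : α} (hx : x ∈ V) (hy : y ∈ V) (hxy : x ≠ y) :
    ∃ h ∈ L.facets V, x ∈ h ∧ y ∉ h := by
  obtain ⟨h, h1, h2, h3⟩ := hT.exists_facet (L.singleton_mem V hT.mem x hx)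
    (Finset.singleton_subset_iff.2 hx) hy (by simpa using hxy.symm)
  exact ⟨h, h1, Finset.singleton_subset_iff.1 h2, h3⟩

lemma eq_of_miss_subset (hT : L.IsTight V) {x y : α} (hx : x ∈ V) (hy : y ∈ V)
    (h : L.miss V y ⊆ L.miss V x) :
    x = y := by
  by_contra hne
  obtain ⟨f, hf, hxf, hyf⟩ := hT.exists_facet_of_ne hx hy hne
  exact (mem_miss.1 (h (mem_miss.2 ⟨hf, hyf⟩))).2 hxf

lemma miss_apex (hT : L.IsTight V) {x : α} (hx : x ∈ L.apexes V) : L.miss V x = {V.erase x} := by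
  rw [mem_apexes] at hx
  ext h
  rw [mem_miss, Finset.mem_singleton]
  constructor
  · rintro ⟨h1, h2⟩
    exact facet_eq_of_subset h1 hx.2 (Finset.subset_erase.2 ⟨(hT.facet_ssubset h1).subset, h2⟩)
  · rintro rfl
    exact ⟨hx.2, by simp⟩

lemma eq_erase_of_not_wide (hT : L.IsTight V) {h : Finset α} (hh : h ∈ L.facets V)
    (hw : h ∉ L.wideFacets V) :
    ∃ x ∈ L.apexes V, h = V.erase x := by
  have hss := hT.facet_ssubset hh
  obtain ⟨x, hxV, hxh⟩ := Finset.exists_of_ssubset hss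
  have h1 : ¬ 2 ≤ (V \ h).card := fun h2 => hw (mem_wideFacets.2 ⟨hh, h2⟩)
  have h2 : h = V.erase x := by
    ext y
    rw [Finset.mem_erase]
    refine ⟨fun hy => ⟨by rintro rfl; exact hxh hy, hss.subset hy⟩, fun hy => ?_⟩
    by_contra hyh
    exact h1 (Finset.one_lt_card.2 ⟨y, by simp [hy.2, hyh], x, by simp [hxV, hxh], hy.1⟩)
  exact ⟨x, mem_apexes.2 ⟨hxV, h2 ▸ hh⟩, h2⟩

lemma wide_of_not_apex (hT : L.IsTight V) {x : α} (hx : x ∈ V) (hxA : x ∉ L.apexes V) {h : Finset α}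
    (hh : h ∈ L.facets V) (hxh : x ∉ h) : h ∈ L.wideFacets V := by
  by_contra hw
  obtain ⟨y, hy, rfl⟩ := hT.eq_erase_of_not_wide hh hw
  have : x = y := by
    by_contra hne
    exact hxh (Finset.mem_erase.2 ⟨hne, hx⟩)
  exact hxA (this ▸ hy)

lemma not_apex_of_wide (hT : L.IsTight V) {x : α} {h : Finset α} (hh : h ∈ L.wideFacets V)
    (hxh : x ∉ h) :
    x ∉ L.apexes V := fun hx => by
  have h1 : h ∈ L.miss V x := mem_miss.2 ⟨(mem_wideFacets.1 hh).1, hxh⟩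
  rw [hT.miss_apex hx, Finset.mem_singleton] at h1
  exact erase_not_wide x (h1 ▸ hh)

lemma exists_wide_facet (hT : L.IsTight V) {x : α} (hx : x ∈ V) (hxA : x ∉ L.apexes V) :
    ∃ F ∈ L.wideFacets V, x ∉ F := by
  obtain ⟨F, hF, -, hxF⟩ := hT.exists_facet L.empty_mem (by simp) hx (by simp)
  exact ⟨F, hT.wide_of_not_apex hx hxA hF hxF, hxF⟩

lemma isSimpleAt (hT : L.IsTight V) {x : α} (hx : x ∈ V) (hxA : x ∉ L.apexes V) :
    L.IsSimpleAt V x := by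
  obtain ⟨F, hF, hxF⟩ := hT.exists_wide_facet hx hxA
  exact hT.simple F hF x (Finset.mem_sdiff.2 ⟨hx, hxF⟩)

lemma card_filter_mem_facets (hT : L.IsTight V) {x : α} (hx : x ∈ V) (hxA : x ∉ L.apexes V) :
    {h ∈ L.facets V | x ∈ h}.card = L.rank V - 1 := by
  rw [← (hT.isSimpleAt hx hxA).card_eq]
  congr 1
  ext h
  rw [mem_interval_singleton, Finset.mem_filter]

/-- A facet that meets the complement of a wide facet misses at most one of its vertices. -/
lemma mem_facet_of_wide (hT : L.IsTight V) {F : Finset α} (hF : F ∈ L.wideFacets V) {u v w : α}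
    (hu : u ∈ V \ F)
    (hv : v ∈ V \ F) (hw : w ∈ V \ F) (huw : w ≠ u) {h : Finset α} (hh : h ∈ L.facets V)
    (hvh : v ∈ h) (huh : u ∉ h) : w ∈ h := by
  by_contra hwh
  obtain ⟨y, -, -, -, -, hy⟩ := (hT.simple F hF v hv).exists_neighbor h
    (mem_interval_singleton.2 ⟨hh, hvh⟩)
  have key : ∀ z ∈ V \ F, z ∉ h → z = y := by
    intro z hz hzh
    have hzv : z ≠ v := by rintro rfl; exact hzh hvh
    refine (hy z (Finset.mem_sdiff.1 hz).1 fun h' hh' hne => ?_).resolve_left hzv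
    rw [mem_interval_singleton] at hh'
    by_contra hzh'
    exact hne (hT.unique F hF z hz v hv hzv h' hh'.1 h hh hh'.2 hvh hzh' hzh)
  exact huw ((key w hw hwh).trans (key u hu huh).symm)

lemma exists_wide (hT : L.IsTight V) : ∃ F, F ∈ L.wideFacets V := by
  obtain ⟨F, hF, h1, h2, h3⟩ := exists_coatom_card_add_two_le hT.mem hT.rank_lt_card
  have h4 := Finset.card_sdiff_add_card_eq_card h1
  exact ⟨F, mem_wideFacets.2 ⟨mem_facets.2 ⟨hF, h1, by omega⟩, by omega⟩⟩

lemma card_facets (hT : L.IsTight V) : (L.facets V).card = L.rank V + 1 := by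
  obtain ⟨F, hF⟩ := hT.exists_wide
  have hF' := mem_wideFacets.1 hF
  obtain ⟨u, hu, v, hv, huv⟩ := Finset.one_lt_card.1 hF'.2
  have hu' := Finset.mem_sdiff.1 hu
  have hv' := Finset.mem_sdiff.1 hv
  obtain ⟨g, hg, hvg, hug⟩ := hT.exists_facet_of_ne hv'.1 hu'.1 huv.symm
  have hmiss : L.miss V u = {F, g} := by
    ext h
    rw [mem_miss, Finset.mem_insert, Finset.mem_singleton]
    constructor
    · rintro ⟨h1, h2⟩
      by_cases hhF : h = F
      · exact Or.inl hhF
      · right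
        have : ∃ z ∈ h, z ∉ F := by
          by_contra! hcon
          exact hhF (facet_eq_of_subset h1 hF'.1 hcon)
        obtain ⟨z, hzh, hzF⟩ := this
        have hz : z ∈ V \ F := Finset.mem_sdiff.2 ⟨(hT.facet_ssubset h1).subset hzh, hzF⟩
        have hvh := hT.mem_facet_of_wide hF hu hz hv huv.symm h1 hzh h2
        exact hT.unique F hF u hu v hv huv h h1 g hg hvh hvg h2 hug
    · rintro (rfl | rfl)
      · exact ⟨hF'.1, hu'.2⟩
      · exact ⟨hg, hug⟩
  have hFg : F ≠ g := by rintro rfl; exact hv'.2 hvg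
  have h1 := hT.card_filter_mem_facets hu'.1 (hT.not_apex_of_wide hF hu'.2)
  have h2 := Finset.card_filter_add_card_filter_not (s := L.facets V) (fun h => u ∈ h)
  have h3 : (L.miss V u).card = 2 := by rw [hmiss, Finset.card_pair hFg]
  rw [miss] at h3
  have := hT.one_lt_rank
  omega

lemma card_miss (hT : L.IsTight V) {x : α} (hx : x ∈ V) (hxA : x ∉ L.apexes V) :
    (L.miss V x).card = 2 := by
  have h1 := hT.card_filter_mem_facets hx hxA
  have h2 := Finset.card_filter_add_card_filter_not (s := L.facets V) (fun h => x ∈ h)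
  have h3 := hT.card_facets
  have := hT.one_lt_rank
  rw [miss]
  omega

lemma card_wideFacets_add (hT : L.IsTight V) :
    (L.wideFacets V).card + (L.apexes V).card = L.rank V + 1 := by
  rw [← hT.card_facets]
  have h1 := Finset.card_filter_add_card_filter_not (s := L.facets V)
    (fun h => 2 ≤ (V \ h).card)
  rw [← h1]
  congr 1
  refine Finset.card_bij (fun x _ => V.erase x) (fun x hx => ?_) (fun x hx y hy hxy => ?_)
    fun h hh => ?_
  · rw [Finset.mem_filter]
    have h2 := (mem_apexes.1 hx).2
    exact ⟨h2, fun h3 => erase_not_wide x (mem_wideFacets.2 ⟨h2, h3⟩)⟩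
  · exact (Finset.erase_inj V (mem_apexes.1 hx).1).1 hxy
  · rw [Finset.mem_filter] at hh
    obtain ⟨x, hx, rfl⟩ := hT.eq_erase_of_not_wide hh.1 fun h3 => hh.2 (mem_wideFacets.1 h3).2
    exact ⟨x, hx, rfl⟩

/-- Some facet misses exactly two vertices. -/
lemma exists_card_sdiff_eq_two (hT : L.IsTight V) : ∃ F ∈ L.wideFacets V, (V \ F).card = 2 := by
  by_contra! hcon
  have hcard : ∀ f ∈ L.wideFacets V, f.card + 1 = L.rank V := fun f hf =>
    (hT.card_sdiff f hf).resolve_left (hcon f hf)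
  obtain ⟨F, hF⟩ := hT.exists_wide
  have hF' := mem_wideFacets.1 hF
  have hFc := hcard F hF
  have hFc2 := hcon F hF
  have hFs := Finset.card_sdiff_add_card_eq_card (hT.facet_ssubset hF'.1).subset
  have hAV : L.apexes V ⊆ V := Finset.filter_subset _ _
  obtain ⟨u, hu, v, hv, huv⟩ := Finset.one_lt_card.1 hF'.2
  have hu' := Finset.mem_sdiff.1 hu
  have hv' := Finset.mem_sdiff.1 hv
  have hdc := Finset.sum_card_bipartiteAbove_eq_sum_card_bipartiteBelow
    (s := V \ L.apexes V) (t := L.wideFacets V) (fun x f => x ∉ f)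
  have h1 : ∀ x ∈ V \ L.apexes V,
      (Finset.bipartiteAbove (fun x f => x ∉ f) (L.wideFacets V) x).card = 2 := by
    intro x hx
    rw [Finset.mem_sdiff] at hx
    rw [← hT.card_miss hx.1 hx.2]
    congr 1
    ext f
    rw [Finset.mem_bipartiteAbove, mem_miss]
    exact ⟨fun h => ⟨(mem_wideFacets.1 h.1).1, h.2⟩,
      fun h => ⟨hT.wide_of_not_apex hx.1 hx.2 h.1 h.2, h.2⟩⟩
  have h2 : ∀ f ∈ L.wideFacets V,
      (Finset.bipartiteBelow (fun x f => x ∉ f) (V \ L.apexes V) f).card = (V \ F).card := by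
    intro f hf
    have hfs := Finset.card_sdiff_add_card_eq_card
      (hT.facet_ssubset (mem_wideFacets.1 hf).1).subset
    have hfc := hcard f hf
    rw [show (V \ F).card = (V \ f).card by omega]
    congr 1
    ext x
    rw [Finset.mem_bipartiteBelow, Finset.mem_sdiff, Finset.mem_sdiff]
    exact ⟨fun h => ⟨h.1.1, h.2⟩, fun h => ⟨⟨h.1, hT.not_apex_of_wide hf h.2⟩, h.2⟩⟩
  rw [Finset.sum_congr rfl h1, Finset.sum_congr rfl h2, Finset.sum_const, Finset.sum_const,
    smul_eq_mul, smul_eq_mul] at hdc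
  obtain ⟨g, hg, hvg, hug⟩ := hT.exists_facet_of_ne hv'.1 hu'.1 huv.symm
  have hgw := hT.wide_of_not_apex hu'.1 (hT.not_apex_of_wide hF hu'.2) hg hug
  have hvA := hT.not_apex_of_wide hF hv'.2
  have hAg : insert v (L.apexes V) ⊆ g := by
    intro x hx
    rw [Finset.mem_insert] at hx
    rcases hx with rfl | hx
    · exact hvg
    · by_contra hxg
      exact hT.not_apex_of_wide hgw hxg hx
  have h3 := Finset.card_le_card hAg
  rw [Finset.card_insert_of_notMem hvA] at h3
  have hgc := hcard g hgw
  have h4 := hT.card_wideFacets_add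
  have h5 := Finset.card_sdiff_add_card_eq_card hAV
  obtain ⟨p, hp⟩ : ∃ p, L.rank V = (L.apexes V).card + 2 + p :=
    ⟨L.rank V - (L.apexes V).card - 2, by omega⟩
  obtain ⟨q, hq⟩ : ∃ q, (V \ F).card = 3 + q := ⟨(V \ F).card - 3, by omega⟩
  rw [show (V \ L.apexes V).card = q + p + 4 by omega, hq,
    show (L.wideFacets V).card = p + 3 by omega] at hdc
  nlinarith [Nat.zero_le (p * q)]

lemma exists_triple (hT : L.IsTight V) {x : α} (hx : x ∈ V) (hxA : x ∉ L.apexes V)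
    {f g h : Finset α} (hfg : L.miss V x = {f, g}) (hh : h ∈ L.wideFacets V) (hhf : h ≠ f)
    (hhg : h ≠ g) :
    ∃ y ∈ V, y ≠ x ∧ (L.miss V y = {f, h} ∨ L.miss V y = {g, h}) ∧
      ∀ z ∈ V, L.miss V z ⊆ {f, g, h} → z = x ∨ z = y := by
  have hh' := mem_wideFacets.1 hh
  have hxh : x ∈ h := by
    by_contra hcon
    have : h ∈ L.miss V x := mem_miss.2 ⟨hh'.1, hcon⟩
    rw [hfg] at this
    simp [hhf, hhg] at this
  obtain ⟨y, hyV, hyx, hyh, hy1, hy2⟩ := (hT.isSimpleAt hx hxA).exists_neighbor h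
    (mem_interval_singleton.2 ⟨hh'.1, hxh⟩)
  have hyA := hT.not_apex_of_wide hh hyh
  have hmem : h ∈ L.miss V y := mem_miss.2 ⟨hh'.1, hyh⟩
  refine ⟨y, hyV, hyx, ?_, fun z hz hzm => hy2 z hz fun h' hh1 hne => ?_⟩
  · have hsub : (L.miss V y).erase h ⊆ {f, g} := by
      intro k hk
      rw [Finset.mem_erase, mem_miss] at hk
      rw [← hfg, mem_miss]
      refine ⟨hk.2.1, fun hxk => hk.2.2 ?_⟩
      exact hy1 k (mem_interval_singleton.2 ⟨hk.2.1, hxk⟩) hk.1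
    obtain ⟨k, hk⟩ := Finset.card_eq_one.1 (show ((L.miss V y).erase h).card = 1 by
      rw [Finset.card_erase_of_mem hmem, hT.card_miss hyV hyA])
    have e : L.miss V y = {k, h} := by
      rw [← Finset.insert_erase hmem, hk, Finset.pair_comm]
    have hk' : k ∈ ({f, g} : Finset (Finset α)) := hsub (hk ▸ Finset.mem_singleton_self k)
    rw [Finset.mem_insert, Finset.mem_singleton] at hk'
    rcases hk' with rfl | rfl
    · exact Or.inl e
    · exact Or.inr e
  · rw [mem_interval_singleton] at hh1
    by_contra hzh
    have h1 := hzm (mem_miss.2 ⟨hh1.1, hzh⟩)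
    have h2 : h' ∉ L.miss V x := fun h3 => (mem_miss.1 h3).2 hh1.2
    rw [hfg] at h2
    simp only [Finset.mem_insert, Finset.mem_singleton] at h1 h2
    tauto

/-- The nonsimplicial structure of a tight face system: away from the apexes, it is that of a
prism over a simplex with bases `X` and `Y`. -/
lemma exists_prism (hT : L.IsTight V) : ∃ X ∈ L.wideFacets V, ∃ Y ∈ L.wideFacets V, X ≠ Y ∧
    (∀ p ∈ L.wideFacets V, p ≠ X → p ≠ Y →
      ∀ t ∈ ({X, Y} : Finset (Finset α)), ∃ x ∈ V, x ∉ L.apexes V ∧ L.miss V x = {t, p}) ∧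
    ∀ x ∈ V, x ∉ L.apexes V → ∃ p ∈ L.wideFacets V, p ≠ X ∧ p ≠ Y ∧
      ∃ t ∈ ({X, Y} : Finset (Finset α)), L.miss V x = {t, p} := by
  obtain ⟨F, hF, hF2⟩ := hT.exists_card_sdiff_eq_two
  obtain ⟨u, w, huw, huwF⟩ := Finset.card_eq_two.1 hF2
  have hu : u ∈ V \ F := huwF ▸ Finset.mem_insert_self u _
  have hw : w ∈ V \ F := huwF ▸ Finset.mem_insert_of_mem (Finset.mem_singleton_self w)
  rw [Finset.mem_sdiff] at hu hw
  have hFw := (mem_wideFacets.1 hF).1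
  have huA := hT.not_apex_of_wide hF hu.2
  have hwA := hT.not_apex_of_wide hF hw.2
  have other : ∀ x ∈ V, x ∉ L.apexes V → ∀ f ∈ L.miss V x, ∃ g ∈ L.wideFacets V,
      g ≠ f ∧ L.miss V x = {g, f} := by
    intro x hx hxA f hf
    obtain ⟨g, hg⟩ := Finset.card_eq_one.1 (show ((L.miss V x).erase f).card = 1 by
      rw [Finset.card_erase_of_mem hf, hT.card_miss hx hxA])
    have hg' : g ∈ (L.miss V x).erase f := hg ▸ Finset.mem_singleton_self g
    rw [Finset.mem_erase, mem_miss] at hg'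
    refine ⟨g, hT.wide_of_not_apex hx hxA hg'.2.1 hg'.2.2, hg'.1, ?_⟩
    rw [← Finset.insert_erase hf, hg, Finset.pair_comm]
  obtain ⟨X, hX, hXF, huX⟩ := other u hu.1 huA F (mem_miss.2 ⟨hFw, hu.2⟩)
  obtain ⟨Y, hY, hYF, hwY⟩ := other w hw.1 hwA F (mem_miss.2 ⟨hFw, hw.2⟩)
  have hXY : X ≠ Y := by
    rintro rfl
    exact huw (hT.eq_of_miss_subset hu.1 hw.1 (by rw [huX, hwY]))
  have hmF : ∀ y ∈ V, F ∈ L.miss V y → y = u ∨ y = w := by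
    intro y hy hyF
    have : y ∈ V \ F := Finset.mem_sdiff.2 ⟨hy, (mem_miss.1 hyF).2⟩
    rw [huwF] at this
    simpa using this
  have hvert : ∀ p ∈ L.wideFacets V, p ≠ X → p ≠ Y →
      ∀ t ∈ ({X, Y} : Finset (Finset α)), ∃ x ∈ V, x ∉ L.apexes V ∧ L.miss V x = {t, p} := by
    intro p hp hpX hpY t ht
    have main : ∀ x ∈ V, x ∉ L.apexes V → (x = u ∨ x = w) → ∀ t ∈ ({X, Y} : Finset (Finset α)),
        L.miss V x = {t, F} → ∃ x ∈ V, x ∉ L.apexes V ∧ L.miss V x = {t, p} := by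
      intro x hx hxA hxuw t ht hxt
      by_cases hpF : p = F
      · exact ⟨x, hx, hxA, hpF ▸ hxt⟩
      have hpt : p ≠ t := by
        rw [Finset.mem_insert, Finset.mem_singleton] at ht
        rcases ht with rfl | rfl <;> assumption
      obtain ⟨y, hy, hyx, hym, -⟩ := hT.exists_triple hx hxA hxt hp hpt hpF
      have hyp : p ∈ L.miss V y := by rcases hym with h | h <;> simp [h]
      have hyA := hT.not_apex_of_wide hp (mem_miss.1 hyp).2
      refine ⟨y, hy, hyA, hym.resolve_right fun h => ?_⟩
      rcases hmF y hy (by simp [h]) with rfl | rfl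
      · rw [huX] at hyp
        simp [hpX, hpF] at hyp
      · rw [hwY] at hyp
        simp [hpY, hpF] at hyp
    have ht' := ht
    rw [Finset.mem_insert, Finset.mem_singleton] at ht'
    rcases ht' with rfl | rfl
    · exact main u hu.1 huA (Or.inl rfl) _ ht huX
    · exact main w hw.1 hwA (Or.inr rfl) _ ht hwY
  refine ⟨X, hX, Y, hY, hXY, hvert, fun x hx hxA => ?_⟩
  have hneF : ∀ f ∈ L.miss V x, f ∈ L.wideFacets V := fun f hf =>
    hT.wide_of_not_apex hx hxA (mem_miss.1 hf).1 (mem_miss.1 hf).2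
  by_cases hXx : X ∈ L.miss V x
  · obtain ⟨p, hp, hpX, hxp⟩ := other x hx hxA X hXx
    by_cases hpY : p = Y
    · subst hpY
      exfalso
      obtain ⟨y, hy, hyx, -, hyz⟩ := hT.exists_triple hx hxA hxp hF hYF.symm hXF.symm
      have h1 := hyz u hu.1 (by simp [huX])
      have h2 := hyz w hw.1 (by simp [hwY, Finset.insert_subset_iff])
      have h3 : F ∉ L.miss V x := by
        rw [hxp]
        simp [hXF.symm, hYF.symm]
      have h4 : u ≠ x := by rintro rfl; exact h3 (by simp [huX])
      have h5 : w ≠ x := by rintro rfl; exact h3 (by simp [hwY])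
      exact huw ((h1.resolve_left h4).trans (h2.resolve_left h5).symm)
    · exact ⟨p, hp, hpX, hpY, X, by simp, by rw [hxp, Finset.pair_comm]⟩
  by_cases hYx : Y ∈ L.miss V x
  · obtain ⟨p, hp, hpY, hxp⟩ := other x hx hxA Y hYx
    refine ⟨p, hp, ?_, hpY, Y, by simp, by rw [hxp, Finset.pair_comm]⟩
    rintro rfl
    exact hXx (by simp [hxp])
  exfalso
  obtain ⟨f, g, hfg, hxfg⟩ := Finset.card_eq_two.1 (hT.card_miss hx hxA)
  have hf : f ∈ L.miss V x := by simp [hxfg]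
  have hg : g ∈ L.miss V x := by simp [hxfg]
  have hne : ∀ k ∈ L.miss V x, k ≠ X ∧ k ≠ Y := fun k hk =>
    ⟨by rintro rfl; exact hXx hk, by rintro rfl; exact hYx hk⟩
  obtain ⟨y1, hy1, -, hm1⟩ := hvert f (hneF f hf) (hne f hf).1 (hne f hf).2 X (by simp)
  obtain ⟨y2, hy2, -, hm2⟩ := hvert g (hneF g hg) (hne g hg).1 (hne g hg).2 X (by simp)
  obtain ⟨y, hy, hyx, -, hyz⟩ := hT.exists_triple hx hxA hxfg hX (hne f hf).1.symm
    (hne g hg).1.symm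
  have h1 := hyz y1 hy1 (by simp [hm1, Finset.insert_subset_iff])
  have h2 := hyz y2 hy2 (by simp [hm2, Finset.insert_subset_iff])
  have h3 : y1 ≠ x := by rintro rfl; exact hXx (by simp [hm1])
  have h4 : y2 ≠ x := by rintro rfl; exact hXx (by simp [hm2])
  have h5 : y1 = y2 := (h1.resolve_left h3).trans (h2.resolve_left h4).symm
  subst h5
  rw [hm1] at hm2
  have h6 : f ∈ ({X, g} : Finset (Finset α)) := hm2 ▸ by simp
  rw [Finset.mem_insert, Finset.mem_singleton] at h6
  exact h6.elim (hne f hf).1 hfg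

/-- The labels of the facets: two bases, `s` wide facets `p i`, and `r` facets opposite to the
apexes. -/
lemma exists_labeling (hT : L.IsTight V) {d s : ℕ} (hr : L.rank V = d + 1) (hc : V.card = d + s)
    (hsd : s ≤ d) : ∃ φ : Bool ⊕ Fin s ⊕ Fin (d - s) → Finset α,
      (∀ w, φ w ∈ L.faces ∧ φ w ⊆ V) ∧
      (∀ F ∈ L.faces, F ⊆ V → ∀ x ∈ V, (∀ w, F ⊆ φ w → x ∈ φ w) → x ∈ F) ∧
      (∀ v ∈ V, (∃ t i, ∀ w, v ∉ φ w ↔ w = .inl t ∨ w = .inr (.inl i)) ∨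
        ∃ j, ∀ w, v ∉ φ w ↔ w = .inr (.inr j)) ∧
      (∀ t i, ∃ v ∈ V, ∀ w, v ∉ φ w ↔ w = .inl t ∨ w = .inr (.inl i)) ∧
      ∀ j, ∃ v ∈ V, ∀ w, v ∉ φ w ↔ w = .inr (.inr j) := by
  obtain ⟨X, hX, Y, hY, hXY, h1, h2⟩ := hT.exists_prism
  set S := ((L.wideFacets V).erase X).erase Y with hS
  have hmS : ∀ p, p ∈ S ↔ p ∈ L.wideFacets V ∧ p ≠ X ∧ p ≠ Y := by
    intro p
    rw [hS, Finset.mem_erase, Finset.mem_erase]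
    tauto
  have hSc : S.card + 2 = (L.wideFacets V).card := by
    rw [hS, ← Finset.card_erase_add_one hX, ← Finset.card_erase_add_one
      (Finset.mem_erase.2 ⟨hXY.symm, hY⟩)]
  have hWA := hT.card_wideFacets_add
  have hAV : L.apexes V ⊆ V := Finset.filter_subset _ _
  have hcA := Finset.card_sdiff_add_card_eq_card hAV
  have himage : (V \ L.apexes V).image (L.miss V) =
      (({X, Y} : Finset (Finset α)) ×ˢ S).image fun q => {q.1, q.2} := by
    ext m
    simp only [Finset.mem_image, Finset.mem_sdiff, Finset.mem_product]
    constructor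
    · rintro ⟨x, ⟨hx, hxA⟩, rfl⟩
      obtain ⟨p, hp, hpX, hpY, t, ht, hm⟩ := h2 x hx hxA
      exact ⟨(t, p), ⟨ht, (hmS p).2 ⟨hp, hpX, hpY⟩⟩, hm.symm⟩
    · rintro ⟨⟨t, p⟩, ⟨ht, hp⟩, rfl⟩
      obtain ⟨hp, hpX, hpY⟩ := (hmS p).1 hp
      obtain ⟨x, hx, hxA, hm⟩ := h1 p hp hpX hpY t ht
      exact ⟨x, ⟨hx, hxA⟩, hm⟩
  have hcount : (V \ L.apexes V).card = 2 * S.card := by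
    have h3 := congrArg Finset.card himage
    rw [Finset.card_image_of_injOn, Finset.card_image_of_injOn, Finset.card_product,
      Finset.card_pair hXY] at h3
    · exact h3
    · rintro ⟨t, p⟩ hq ⟨t', p'⟩ hq' he
      simp only [Finset.coe_product, Set.mem_prod, Finset.mem_coe, hmS, Finset.mem_insert,
        Finset.mem_singleton] at hq hq'
      have e1 : p ∈ ({t', p'} : Finset (Finset α)) := by
        rw [← show ({t, p} : Finset (Finset α)) = {t', p'} from he]
        simp
      have e2 : t ∈ ({t', p'} : Finset (Finset α)) := by
        rw [← show ({t, p} : Finset (Finset α)) = {t', p'} from he]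
        simp
      rw [Finset.mem_insert, Finset.mem_singleton] at e1 e2
      rw [Prod.mk.injEq]
      grind
    · intro x hx y hy he
      exact hT.eq_of_miss_subset (Finset.mem_sdiff.1 hx).1 (Finset.mem_sdiff.1 hy).1
        (show L.miss V x = L.miss V y from he).ge
  let eS := S.equivFinOfCardEq (show S.card = s by omega)
  let eA := (L.apexes V).equivFinOfCardEq (show (L.apexes V).card = d - s by omega)
  let φ : Bool ⊕ Fin s ⊕ Fin (d - s) → Finset α :=
    Sum.elim (fun t => if t then X else Y)
      (Sum.elim (fun i => (eS.symm i).1) fun j => V.erase (eA.symm j).1)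
  have hφX : φ (.inl true) = X := rfl
  have hφY : φ (.inl false) = Y := rfl
  have hφt : ∀ t, φ (.inl t) ∈ ({X, Y} : Finset (Finset α)) := by
    rintro (_ | _)
    · rw [hφY]; simp
    · rw [hφX]; simp
  have hφS : ∀ i, φ (.inr (.inl i)) ∈ S := fun i => (eS.symm i).2
  have hφA : ∀ j, φ (.inr (.inr j)) = V.erase (eA.symm j).1 := fun j => rfl
  have hfac : ∀ w, φ w ∈ L.facets V := by
    rintro ((_ | _) | i | j)
    · exact (mem_wideFacets.1 hY).1
    · exact (mem_wideFacets.1 hX).1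
    · exact (mem_wideFacets.1 ((hmS _).1 (hφS i)).1).1
    · exact (mem_apexes.1 (eA.symm j).2).2
  have hsurj : ∀ h ∈ L.facets V, ∃ w, φ w = h := by
    intro h hh
    by_cases hw : h ∈ L.wideFacets V
    · by_cases hhX : h = X
      · exact ⟨.inl true, hhX ▸ hφX⟩
      by_cases hhY : h = Y
      · exact ⟨.inl false, hhY ▸ hφY⟩
      refine ⟨.inr (.inl (eS ⟨h, (hmS h).2 ⟨hw, hhX, hhY⟩⟩)), ?_⟩
      show (eS.symm (eS _)).1 = h
      rw [Equiv.symm_apply_apply]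
    · obtain ⟨x, hx, rfl⟩ := hT.eq_erase_of_not_wide hh hw
      refine ⟨.inr (.inr (eA ⟨x, hx⟩)), ?_⟩
      rw [hφA, Equiv.symm_apply_apply]
  have hinj : Function.Injective φ := by
    have hwide : ∀ j, φ (.inr (.inr j)) ∉ L.wideFacets V := fun j => erase_not_wide _
    have hne1 : ∀ t j, φ (.inl t) ≠ φ (.inr (.inr j)) := by
      intro t j he
      have h3 := hφt t
      rw [he, Finset.mem_insert, Finset.mem_singleton] at h3
      rcases h3 with h3 | h3
      · exact hwide j (h3 ▸ hX)
      · exact hwide j (h3 ▸ hY)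
    have hne2 : ∀ i j, φ (.inr (.inl i)) ≠ φ (.inr (.inr j)) := fun i j he =>
      hwide j (he ▸ ((hmS _).1 (hφS i)).1)
    have hne3 : ∀ t i, φ (.inl t) ≠ φ (.inr (.inl i)) := by
      intro t i he
      have h3 := hφt t
      rw [he, Finset.mem_insert, Finset.mem_singleton] at h3
      have h4 := (hmS _).1 (hφS i)
      exact h3.elim h4.2.1 h4.2.2
    rintro (t | i | j) (t' | i' | j') he
    · rcases t with _ | _ <;> rcases t' with _ | _
      exacts [rfl, absurd he hXY.symm, absurd he hXY, rfl]
    · exact absurd he (hne3 _ _)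
    · exact absurd he (hne1 _ _)
    · exact absurd he.symm (hne3 _ _)
    · exact congrArg (fun i => Sum.inr (Sum.inl i)) (eS.symm.injective (Subtype.ext he))
    · exact absurd he (hne2 _ _)
    · exact absurd he.symm (hne1 _ _)
    · exact absurd he.symm (hne2 _ _)
    · refine congrArg (fun i => Sum.inr (Sum.inr i)) (eA.symm.injective (Subtype.ext ?_))
      rw [hφA, hφA] at he
      exact (Finset.erase_inj V (hAV (eA.symm j).2)).1 he
  have hnot : ∀ v w, v ∉ φ w ↔ φ w ∈ L.miss V v := fun v w =>
    ⟨fun h => mem_miss.2 ⟨hfac w, h⟩, fun h => (mem_miss.1 h).2⟩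
  have hlabel : ∀ v t i, L.miss V v = {φ (.inl t), φ (.inr (.inl i))} →
      ∀ w, v ∉ φ w ↔ w = .inl t ∨ w = .inr (.inl i) := by
    intro v t i hm w
    rw [hnot, hm, Finset.mem_insert, Finset.mem_singleton, hinj.eq_iff, hinj.eq_iff]
  have happex : ∀ j w, (eA.symm j).1 ∉ φ w ↔ w = .inr (.inr j) := by
    intro j w
    rw [hnot, hT.miss_apex (eA.symm j).2, Finset.mem_singleton, ← hφA, hinj.eq_iff]
  refine ⟨φ, fun w => ⟨(mem_facets.1 (hfac w)).1, (mem_facets.1 (hfac w)).2.1⟩, ?_, ?_, ?_,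
    fun j => ⟨_, hAV (eA.symm j).2, happex j⟩⟩
  · intro F hF hFV x hx hw
    by_contra hxF
    obtain ⟨h, hh, hFh, hxh⟩ := hT.exists_facet hF hFV hx hxF
    obtain ⟨w, rfl⟩ := hsurj h hh
    exact hxh (hw w hFh)
  · intro v hv
    by_cases hvA : v ∈ L.apexes V
    · refine Or.inr ⟨eA ⟨v, hvA⟩, fun w => ?_⟩
      rw [← happex, Equiv.symm_apply_apply]
    · obtain ⟨p, hp, hpX, hpY, t, ht, hm⟩ := h2 v hv hvA
      obtain ⟨b, rfl⟩ : ∃ b, φ (.inl b) = t := by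
        rw [Finset.mem_insert, Finset.mem_singleton] at ht
        rcases ht with rfl | rfl
        exacts [⟨true, rfl⟩, ⟨false, rfl⟩]
      refine Or.inl ⟨b, eS ⟨p, (hmS p).2 ⟨hp, hpX, hpY⟩⟩, hlabel _ _ _ ?_⟩
      rw [hm]
      congr 2
      show p = (eS.symm (eS _)).1
      rw [Equiv.symm_apply_apply]
  · intro t i
    obtain ⟨hp, hpX, hpY⟩ := (hmS _).1 (hφS i)
    obtain ⟨x, hx, -, hm⟩ := h1 _ hp hpX hpY _ (hφt t)
    exact ⟨x, hx, hlabel _ _ _ hm⟩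

end IsTight

end FaceSystem

/-- Equality in Grünbaum's lower bound forces a face system to be tight. -/
lemma FaceSystem.isTight_of_grunbaum_eq {α : Type*} [DecidableEq α] {L : FaceSystem α}
    {V : Finset α} (hV : V ∈ L.faces) (hc : V.card + 2 ≤ 2 * L.rank V) (hlt : L.rank V < V.card)
    {k : ℕ} (hk1 : 1 ≤ k) (hk2 : k + 3 ≤ L.rank V)
    (heq : (L.interval ∅ V (k + 1)).card + (2 * L.rank V - 1 - V.card).choose (k + 1) ≤
      (L.rank V).choose (k + 1) + (L.rank V - 1).choose (k + 1)) : L.IsTight V := by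
  have key : ∀ F ∈ L.wideFacets V, (V \ F).card ≤ L.rank V ∧
      (L.meeting V (V \ F) (k + 1)).card ≤
        ∑ i ∈ Finset.range (V \ F).card, (L.rank V - 1 - i).choose k ∧
      ((V \ F).card = 2 ∨ F.card + 1 = L.rank V) := by
    intro F hF
    obtain ⟨hF, hF2⟩ := mem_wideFacets.1 hF
    obtain ⟨hF, hFV, hFr⟩ := mem_facets.1 hF
    have h1 := rank_le_card hF
    have h2 := Finset.card_sdiff_add_card_eq_card hFV
    exact ⟨by omega, tight_of_grunbaum_eq hV hc hk1 hk2 heq hF hFV (by omega) hF2⟩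
  refine ⟨hV, by omega, fun F hF v hv => ?_, fun F hF u hu v hv huv h hh h' hh' hvh hvh' => ?_,
    fun F hF => (key F hF).2.2, hlt⟩
  · exact isSimpleAt_of_tight hV Finset.sdiff_subset (key F hF).1 hk1 (by omega) (key F hF).2.1 hv
  · exact facet_unique_of_tight hV Finset.sdiff_subset (key F hF).1 hk1 (by omega) (key F hF).2.1
      hu hv huv (mem_interval_singleton.2 ⟨hh, hvh⟩) (mem_interval_singleton.2 ⟨hh', hvh'⟩)

/-- The faces of the `r`-fold pyramid over the bipyramid over an `(s - 1)`-simplex, as sets of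
vertices: the two apices of the bipyramid form the left summand, the vertices of the simplex the
middle one, and the other vertices the right one. -/
def bipyramidFaces (s r : ℕ) : Set (Set (Bool ⊕ Fin s ⊕ Fin r)) :=
  {G | (∀ t, .inl t ∈ G) ↔ ∀ i, .inr (.inl i) ∈ G}

lemma FaceSystem.exists_mem_faces_forall {α ι : Type*} [DecidableEq α] (L : FaceSystem α)
    {V : Finset α} (hV : V ∈ L.faces) {φ : ι → Finset α} (hφ : ∀ w, φ w ∈ L.faces)
    (G : Finset ι) : ∃ F ∈ L.faces, ∀ v, v ∈ F ↔ v ∈ V ∧ ∀ w ∈ G, v ∈ φ w := by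
  classical
  induction G using Finset.induction_on with
  | empty => exact ⟨V, hV, by simp⟩
  | insert w G _ ih =>
    obtain ⟨F, hF, h⟩ := ih
    refine ⟨F ∩ φ w, L.inter_mem _ hF _ (hφ w), fun v => ?_⟩
    rw [Finset.mem_inter, h, Finset.forall_mem_insert]
    tauto

/-- A face system whose facets are labelled as in a tight one is dual to `bipyramidFaces`. -/
lemma FaceSystem.nonempty_orderIso {α : Type*} [DecidableEq α] (L : FaceSystem α) {V : Finset α}
    (hV : V ∈ L.faces) {s r : ℕ} (φ : Bool ⊕ Fin s ⊕ Fin r → Finset α)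
    (hφ : ∀ w, φ w ∈ L.faces ∧ φ w ⊆ V)
    (hfacets : ∀ F ∈ L.faces, F ⊆ V → ∀ x ∈ V, (∀ w, F ⊆ φ w → x ∈ φ w) → x ∈ F)
    (hvert : ∀ v ∈ V, (∃ t i, ∀ w, v ∉ φ w ↔ w = .inl t ∨ w = .inr (.inl i)) ∨
        ∃ j, ∀ w, v ∉ φ w ↔ w = .inr (.inr j))
    (hbase : ∀ t i, ∃ v ∈ V, ∀ w, v ∉ φ w ↔ w = .inl t ∨ w = .inr (.inl i))
    (hapex : ∀ j, ∃ v ∈ V, ∀ w, v ∉ φ w ↔ w = .inr (.inr j)) :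
    Nonempty ({F : Finset α // F ∈ L.faces ∧ F ⊆ V} ≃o (bipyramidFaces s r)ᵒᵈ) := by
  classical
  let g : Finset α → Set (Bool ⊕ Fin s ⊕ Fin r) := fun F => {w | F ⊆ φ w}
  let f : Set (Bool ⊕ Fin s ⊕ Fin r) → Finset α := fun G => {v ∈ V | ∀ w ∈ G.toFinset, v ∈ φ w}
  have hmf : ∀ G v, v ∈ f G ↔ v ∈ V ∧ ∀ w ∈ G, v ∈ φ w := by
    intro G v
    simp only [f, Finset.mem_filter, Set.mem_toFinset]
  have hg : ∀ F, F ⊆ V → g F ∈ bipyramidFaces s r := by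
    intro F hFV
    constructor
    · intro h i v hv
      rcases hvert v (hFV hv) with ⟨t, i', hw⟩ | ⟨j, hw⟩
      · exact absurd (h t hv) ((hw _).2 (Or.inl rfl))
      · by_contra hcon
        simpa using (hw _).1 hcon
    · intro h t v hv
      rcases hvert v (hFV hv) with ⟨t', i, hw⟩ | ⟨j, hw⟩
      · exact absurd (h i hv) ((hw _).2 (Or.inr rfl))
      · by_contra hcon
        simpa using (hw _).1 hcon
  have hfg : ∀ F ∈ L.faces, F ⊆ V → f (g F) = F := by
    intro F hF hFV
    ext v
    rw [hmf]
    exact ⟨fun h => hfacets F hF hFV v h.1 h.2, fun h => ⟨hFV h, fun w hw => hw h⟩⟩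
  have hgf : ∀ G ∈ bipyramidFaces s r, g (f G) = G := by
    intro G hG
    refine Set.Subset.antisymm (fun w hw => ?_) fun w hw v hv => ((hmf G v).1 hv).2 w hw
    by_contra hwG
    have key : ∀ v ∈ V, v ∉ φ w → (∀ w', v ∉ φ w' → w' ∉ G) → False := by
      intro v hv hvw h
      refine hvw (hw ((hmf G v).2 ⟨hv, fun w' hw' => ?_⟩))
      by_contra hcon
      exact h w' hcon hw'
    rcases w with t | i | j
    · obtain ⟨i, hi⟩ := not_forall.1 fun h => hwG (hG.2 h t)
      obtain ⟨v, hv, hvw⟩ := hbase t i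
      refine key v hv ((hvw _).2 (Or.inl rfl)) fun w' hw' => ?_
      rcases (hvw w').1 hw' with rfl | rfl <;> assumption
    · obtain ⟨t, ht⟩ := not_forall.1 fun h => hwG (hG.1 h i)
      obtain ⟨v, hv, hvw⟩ := hbase t i
      refine key v hv ((hvw _).2 (Or.inr rfl)) fun w' hw' => ?_
      rcases (hvw w').1 hw' with rfl | rfl <;> assumption
    · obtain ⟨v, hv, hvw⟩ := hapex j
      refine key v hv ((hvw _).2 rfl) fun w' hw' => ?_
      rw [(hvw w').1 hw']
      exact hwG
  have hf : ∀ G, f G ∈ L.faces := by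
    intro G
    obtain ⟨F, hF, h⟩ := L.exists_mem_faces_forall hV (fun w => (hφ w).1) G.toFinset
    convert hF using 1
    ext v
    rw [hmf, h]
    simp only [Set.mem_toFinset]
  refine ⟨⟨⟨fun F => OrderDual.toDual ⟨g F.1, hg F.1 F.2.2⟩,
    fun G => ⟨f (OrderDual.ofDual G).1, hf _, Finset.filter_subset _ _⟩,
      fun F => Subtype.ext (hfg F.1 F.2.1 F.2.2),
      fun G => Subtype.ext (hgf _ (OrderDual.ofDual G).2)⟩, fun {F F'} => ?_⟩⟩
  show g F'.1 ⊆ g F.1 ↔ F.1 ⊆ F'.1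
  refine ⟨fun h => ?_, fun h w hw => h.trans hw⟩
  rw [← hfg F.1 F.2.1 F.2.2, ← hfg F'.1 F'.2.1 F'.2.2]
  intro v hv
  rw [hmf] at hv ⊢
  exact ⟨hv.1, fun w hw => hv.2 w (h hw)⟩

section ConeFaces

variable {α W : Type*} [AddCommGroup W] [Module ℝ W]

open Classical in
/-- The faces of the cone generated by the vectors `e v`, `v ∈ V`, as sets of indices. -/
noncomputable def coneFaces (e : α → W) (V : Finset α) : Finset (Finset α) :=
  {S ∈ V.powerset | ∃ f : W →ₗ[ℝ] ℝ, (∀ v ∈ V, f (e v) ≤ 0) ∧ ∀ v ∈ V, v ∈ S ↔ f (e v) = 0}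

variable {e : α → W} {V F G : Finset α}

lemma mem_coneFaces {S : Finset α} : S ∈ coneFaces e V ↔ S ⊆ V ∧ ∃ f : W →ₗ[ℝ] ℝ,
    (∀ v ∈ V, f (e v) ≤ 0) ∧ ∀ v ∈ V, v ∈ S ↔ f (e v) = 0 := by
  classical
  rw [coneFaces, Finset.mem_filter, Finset.mem_powerset]

lemma self_mem_coneFaces : V ∈ coneFaces e V :=
  mem_coneFaces.2 ⟨subset_rfl, 0, by simp, by simp⟩

lemma inter_mem_coneFaces [DecidableEq α] (hF : F ∈ coneFaces e V) (hG : G ∈ coneFaces e V) :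
    F ∩ G ∈ coneFaces e V := by
  obtain ⟨hFV, f, hf, hfF⟩ := mem_coneFaces.1 hF
  obtain ⟨-, g, hg, hgG⟩ := mem_coneFaces.1 hG
  refine mem_coneFaces.2 ⟨Finset.inter_subset_left.trans hFV, f + g, fun v hv => ?_,
    fun v hv => ?_⟩
  · rw [LinearMap.add_apply]
    linarith [hf v hv, hg v hv]
  · rw [Finset.mem_inter, hfF v hv, hgG v hv, LinearMap.add_apply]
    have h1 := hf v hv
    have h2 := hg v hv
    exact ⟨fun h => by rw [h.1, h.2, add_zero], fun h => ⟨by linarith, by linarith⟩⟩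

lemma exists_forall_mul_add_neg (V : Finset α) (f g : α → ℝ) :
    ∃ N : ℝ, ∀ v ∈ V, f v < 0 → N * f v + g v < 0 := by
  have : ∀ᶠ N : ℝ in Filter.atTop, ∀ v ∈ V, f v < 0 → N * f v + g v < 0 := by
    rw [Filter.eventually_all_finset]
    intro v _
    filter_upwards [Filter.eventually_gt_atTop (g v / -f v)] with N hN hv
    rw [div_lt_iff₀ (by linarith)] at hN
    linarith
  exact this.exists

/-- A face of a face is a face. -/
lemma mem_coneFaces_trans (hG : G ∈ coneFaces e V) (hF : F ∈ coneFaces e G) :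
    F ∈ coneFaces e V := by
  obtain ⟨hGV, g, hg, hgG⟩ := mem_coneFaces.1 hG
  obtain ⟨hFG, f, hf, hfF⟩ := mem_coneFaces.1 hF
  obtain ⟨N, hN⟩ := exists_forall_mul_add_neg V (fun v => g (e v)) fun v => f (e v)
  have key : ∀ v ∈ V, v ∉ G → (N • g + f) (e v) < 0 := fun v hv hvG =>
    hN v hv (lt_of_le_of_ne (hg v hv) fun h => hvG ((hgG v hv).2 h))
  have key2 : ∀ v ∈ G, (N • g + f) (e v) = f (e v) := fun v hv => by
    rw [LinearMap.add_apply, LinearMap.smul_apply, (hgG v (hGV hv)).1 hv, smul_zero, zero_add]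
  refine mem_coneFaces.2 ⟨hFG.trans hGV, N • g + f, fun v hv => ?_, fun v hv => ?_⟩
  · by_cases hvG : v ∈ G
    · rw [key2 v hvG]
      exact hf v hvG
    · exact (key v hv hvG).le
  · by_cases hvG : v ∈ G
    · rw [key2 v hvG, hfF v hvG]
    · exact ⟨fun h => absurd (hFG h) hvG, fun h => absurd h (key v hv hvG).ne⟩

lemma finrank_span_lt_of_ssubset [FiniteDimensional ℝ W] (hF : F ∈ coneFaces e V) (hG : G ⊆ V)
    (hFG : F ⊂ G) :
    Module.finrank ℝ (Submodule.span ℝ (e '' F)) <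
      Module.finrank ℝ (Submodule.span ℝ (e '' G)) := by
  obtain ⟨-, f, -, hfF⟩ := mem_coneFaces.1 hF
  obtain ⟨y, hyG, hyF⟩ := Finset.exists_of_ssubset hFG
  refine Submodule.finrank_lt_finrank_of_lt (lt_of_le_of_ne
    (Submodule.span_mono (Set.image_mono (Finset.coe_subset.2 hFG.subset))) fun h => ?_)
  have h1 : Submodule.span ℝ (e '' F) ≤ LinearMap.ker f := by
    rw [Submodule.span_le]
    rintro _ ⟨v, hv, rfl⟩
    exact (hfF v (hG (hFG.subset hv))).1 hv
  have h2 : e y ∈ Submodule.span ℝ (e '' G) := Submodule.subset_span ⟨y, hyG, rfl⟩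
  exact hyF ((hfF y (hG hyG)).2 (h1 (h ▸ h2)))

/-- A face `F` avoiding `x` is not maximal with this property if `F` and `x` do not span all the
vectors. -/
lemma exists_larger_coneFace (hF : F ∈ coneFaces e V) {x y : α} (hy : y ∈ V)
    (hyF : e y ∉ Submodule.span ℝ (insert (e x) (e '' F))) (hxF : x ∉ F) (hx : x ∈ V) :
    ∃ H ∈ coneFaces e V, F ⊂ H ∧ x ∉ H := by
  obtain ⟨hFV, f, hf, hfF⟩ := mem_coneFaces.1 hF
  obtain ⟨g, hgy, hg⟩ : ∃ g : W →ₗ[ℝ] ℝ, 0 < g (e y) ∧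
      ∀ z ∈ Submodule.span ℝ (insert (e x) (e '' F)), g z = 0 := by
    obtain ⟨g, hgy, hg⟩ := Submodule.exists_le_ker_of_notMem hyF
    rcases lt_or_gt_of_ne hgy with h | h
    · exact ⟨-g, by simpa using h, fun z hz => by simpa using hg hz⟩
    · exact ⟨g, h, fun z hz => hg hz⟩
  have hgx : g (e x) = 0 := hg _ (Submodule.subset_span (Set.mem_insert _ _))
  have hgF : ∀ v ∈ F, g (e v) = 0 := fun v hv =>
    hg _ (Submodule.subset_span (Set.mem_insert_of_mem _ ⟨v, hv, rfl⟩))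
  obtain ⟨z, hz, hmin⟩ := Finset.exists_min_image {v ∈ V | 0 < g (e v)}
    (fun v => -f (e v) / g (e v)) ⟨y, Finset.mem_filter.2 ⟨hy, hgy⟩⟩
  rw [Finset.mem_filter] at hz
  set t := -f (e z) / g (e z) with ht
  have ht0 : 0 ≤ t := div_nonneg (by linarith [hf z hz.1]) hz.2.le
  have hfx : f (e x) < 0 := lt_of_le_of_ne (hf x hx) fun h => hxF ((hfF x hx).2 h)
  classical
  refine ⟨{v ∈ V | (f + t • g) (e v) = 0}, mem_coneFaces.2 ⟨Finset.filter_subset _ _, f + t • g,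
    fun v hv => ?_, fun v hv => by simp [hv]⟩, Finset.ssubset_iff_subset_ne.2
    ⟨fun v hv => ?_, fun h => ?_⟩, fun h => ?_⟩
  · rw [LinearMap.add_apply, LinearMap.smul_apply, smul_eq_mul]
    rcases le_or_gt (g (e v)) 0 with h | h
    · nlinarith [hf v hv]
    · have h1 := hmin v (Finset.mem_filter.2 ⟨hv, h⟩)
      rw [le_div_iff₀ h] at h1
      linarith
  · refine Finset.mem_filter.2 ⟨hFV hv, ?_⟩
    rw [LinearMap.add_apply, LinearMap.smul_apply, hgF v hv, (hfF v (hFV hv)).1 hv]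
    simp
  · have h1 : z ∈ F := by
      rw [h, Finset.mem_filter, LinearMap.add_apply, LinearMap.smul_apply, smul_eq_mul, ht,
        div_mul_cancel₀ _ hz.2.ne']
      exact ⟨hz.1, by ring⟩
    rw [hgF z h1] at hz
    exact lt_irrefl _ hz.2
  · have h1 := (Finset.mem_filter.1 h).2
    rw [LinearMap.add_apply, LinearMap.smul_apply, hgx, smul_zero, add_zero] at h1
    exact hfx.ne h1

lemma exists_coatom_coneFaces [FiniteDimensional ℝ W] (hF : F ∈ coneFaces e V) {x : α}
    (hx : x ∈ V) (hxF : x ∉ F) :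
    ∃ H ∈ coneFaces e V, F ⊆ H ∧ x ∉ H ∧
      Module.finrank ℝ (Submodule.span ℝ (e '' H)) + 1 =
        Module.finrank ℝ (Submodule.span ℝ (e '' V)) := by
  classical
  obtain ⟨H, hH, hmax⟩ := Finset.exists_max_image {H ∈ coneFaces e V | F ⊆ H ∧ x ∉ H} Finset.card
    ⟨F, Finset.mem_filter.2 ⟨hF, subset_rfl, hxF⟩⟩
  obtain ⟨hH, hFH, hxH⟩ := Finset.mem_filter.1 hH
  have hHV := (mem_coneFaces.1 hH).1
  refine ⟨H, hH, hFH, hxH, le_antisymm ?_ ?_⟩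
  · exact finrank_span_lt_of_ssubset hH subset_rfl
      (Finset.ssubset_iff_subset_ne.2 ⟨hHV, by rintro rfl; exact hxH hx⟩)
  · by_contra hlt
    rw [not_le] at hlt
    have h1 : ∃ y ∈ V, e y ∉ Submodule.span ℝ (insert (e x) (e '' H)) := by
      by_contra! hcon
      have h2 : Submodule.span ℝ (e '' V) ≤ Submodule.span ℝ (insert (e x) (e '' H)) := by
        rw [Submodule.span_le]
        rintro _ ⟨v, hv, rfl⟩
        exact hcon v hv
      have h3 := Submodule.finrank_mono h2
      rw [Submodule.span_insert] at h3
      have h4 := Submodule.finrank_add_le_finrank_add_finrank (Submodule.span ℝ {e x})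
        (Submodule.span ℝ (e '' H))
      have h5 := finrank_span_le_card (R := ℝ) ({e x} : Set W)
      simp only [Set.toFinset_singleton, Finset.card_singleton] at h5
      omega
    obtain ⟨y, hy, hyH⟩ := h1
    obtain ⟨H', hH', hHH', hxH'⟩ := exists_larger_coneFace hH hy hyH hxH hx
    have := hmax H' (Finset.mem_filter.2 ⟨hH', hFH.trans hHH'.subset, hxH'⟩)
    exact absurd (Finset.card_lt_card hHH') (not_lt.2 this)

lemma eq_zero_or_mul_neg {a b p q : ℝ} (hp : p < 0) (hq : q < 0) (h : a * p + b * q = 0) :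
    (a = 0 ∧ b = 0) ∨ a * b < 0 := by
  have ha : a = -(b * q) / p := by
    rw [eq_div_iff hp.ne]
    linarith
  by_cases hb : b = 0
  · exact Or.inl ⟨by rw [ha, hb]; simp, hb⟩
  · right
    have h1 : a * b = -(b ^ 2 * (q / p)) := by
      rw [ha]
      ring
    have h2 : 0 < b ^ 2 := by positivity
    have h3 : 0 < q / p := div_pos_of_neg_of_neg hq hp
    rw [h1]
    nlinarith [mul_pos h2 h3]

lemma card_eq_two_of_finrank [FiniteDimensional ℝ W] (h1 : ∀ v ∈ V, {v} ∈ coneFaces e V)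
    (hF : F ⊆ V) (hr : Module.finrank ℝ (Submodule.span ℝ (e '' F)) = 2) : F.card = 2 := by
  classical
  apply le_antisymm
  · by_contra! h3
    obtain ⟨a, ha, b, hb, c, hc, hab, hac, hbc⟩ := Finset.two_lt_card.1 h3
    have hdep : ¬ LinearIndependent ℝ ![e a, e b, e c] := by
      intro hli
      have h4 := finrank_span_eq_card hli
      have h5 : Submodule.span ℝ (Set.range ![e a, e b, e c]) ≤ Submodule.span ℝ (e '' F) := by
        refine Submodule.span_mono ?_
        rintro _ ⟨i, rfl⟩
        fin_cases i
        exacts [⟨a, ha, rfl⟩, ⟨b, hb, rfl⟩, ⟨c, hc, rfl⟩]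
      have h6 := Submodule.finrank_mono h5
      rw [h4, hr, Fintype.card_fin] at h6
      omega
    rw [Fintype.not_linearIndependent_iff] at hdep
    obtain ⟨g, hg, i, hi⟩ := hdep
    rw [Fin.sum_univ_three] at hg
    simp only [Matrix.cons_val_zero, Matrix.cons_val_one, Matrix.cons_val] at hg
    have hneg : ∀ v ∈ F, ∃ f : W →ₗ[ℝ] ℝ, f (e v) = 0 ∧ ∀ w ∈ F, w ≠ v → f (e w) < 0 := by
      intro v hv
      obtain ⟨-, f, hf, hfv⟩ := mem_coneFaces.1 (h1 v (hF hv))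
      refine ⟨f, (hfv v (hF hv)).1 (Finset.mem_singleton_self v), fun w hw hwv => ?_⟩
      refine lt_of_le_of_ne (hf w (hF hw)) fun h => hwv ?_
      exact Finset.mem_singleton.1 ((hfv w (hF hw)).2 h)
    obtain ⟨fa, hfa, hfa'⟩ := hneg a ha
    obtain ⟨fb, hfb, hfb'⟩ := hneg b hb
    obtain ⟨fc, hfc, hfc'⟩ := hneg c hc
    have ea := congrArg fa hg
    have eb := congrArg fb hg
    have ec := congrArg fc hg
    simp only [map_add, map_smul, smul_eq_mul, map_zero, hfa, hfb, hfc, mul_zero, add_zero,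
      zero_add] at ea eb ec
    have ea' := eq_zero_or_mul_neg (hfa' b hb hab.symm) (hfa' c hc hac.symm) ea
    have eb' := eq_zero_or_mul_neg (hfb' a ha hab) (hfb' c hc hbc.symm) eb
    have ec' := eq_zero_or_mul_neg (hfc' a ha hac) (hfc' b hb hbc) ec
    have hne : ¬ (g 0 = 0 ∧ g 1 = 0 ∧ g 2 = 0) := by
      rintro ⟨h4, h5, h6⟩
      fin_cases i <;> contradiction
    rcases ea' with ea' | ea' <;> rcases eb' with eb' | eb' <;> rcases ec' with ec' | ec'
    · exact hne ⟨eb'.1, ea'⟩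
    · exact hne ⟨eb'.1, ea'⟩
    · exact hne ⟨ec'.1, ea'⟩
    · rw [ea'.1] at ec'
      simp at ec'
    · exact hne ⟨eb'.1, ec'.2, eb'.2⟩
    · rw [eb'.2] at ea'
      simp at ea'
    · rw [ec'.2] at ea'
      simp at ea'
    · have h7 := mul_pos (mul_pos_of_neg_of_neg ea' eb') (neg_pos.2 ec')
      nlinarith [sq_nonneg (g 0 * g 1 * g 2)]
  · rw [← hr]
    have h2 := finrank_span_finset_le_card (R := ℝ) (F.image e)
    rw [Finset.coe_image] at h2
    exact h2.trans Finset.card_image_le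

/-- The face system of a pointed cone, given by vectors spanning distinct extreme rays. -/
noncomputable def coneFaceSystem [DecidableEq α] [FiniteDimensional ℝ W] (e : α → W)
    (V : Finset α) (h0 : ∅ ∈ coneFaces e V)
    (h1 : ∀ v ∈ V, {v} ∈ coneFaces e V) : FaceSystem α where
  faces := coneFaces e V
  rank F := Module.finrank ℝ (Submodule.span ℝ (e '' F))
  rank_empty := by simp
  empty_mem := h0
  singleton_mem F hF v hv := h1 v ((mem_coneFaces.1 hF).1 hv)
  rank_singleton v hv := by
    obtain ⟨-, f, -, hf⟩ := mem_coneFaces.1 h0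
    have h2 : e v ≠ 0 := fun h => by
      simpa [h] using hf v ((mem_coneFaces.1 hv).1 (Finset.mem_singleton_self v))
    rw [Finset.coe_singleton, Set.image_singleton, finrank_span_singleton h2]
  inter_mem F hF G hG := inter_mem_coneFaces hF hG
  rank_lt F hF G hG hFG := finrank_span_lt_of_ssubset hF (mem_coneFaces.1 hG).1 hFG
  exists_coatom F hF G hG hFG x hx hxF := by
    obtain ⟨hFV, f, hf, hfF⟩ := mem_coneFaces.1 hF
    have hGV := (mem_coneFaces.1 hG).1
    have hFG' : F ∈ coneFaces e G :=
      mem_coneFaces.2 ⟨hFG, f, fun v hv => hf v (hGV hv), fun v hv => hfF v (hGV hv)⟩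
    obtain ⟨H, hH, hFH, hxH, hr⟩ := exists_coatom_coneFaces hFG' hx hxF
    exact ⟨H, mem_coneFaces_trans hG hH, hFH, (mem_coneFaces.1 hH).1, hxH, hr⟩
  card_of_rank_two F hF hr := card_eq_two_of_finrank h1 (mem_coneFaces.1 hF).1 hr

end ConeFaces

section Polytope

variable {E : Type*} [AddCommGroup E] [Module ℝ E]

lemma setOf_mem_convexHull_eq (V : Finset E) (f : E →ₗ[ℝ] ℝ) {c : ℝ} (hf : ∀ v ∈ V, f v ≤ c) :
    {x ∈ convexHull ℝ (V : Set E) | f x = c} = convexHull ℝ {v | v ∈ V ∧ f v = c} := by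
  classical
  apply Set.Subset.antisymm
  · rintro x ⟨hx, hfx⟩
    obtain ⟨w, hw0, hw1, hwx⟩ := Finset.mem_convexHull'.1 hx
    have h1 : ∑ v ∈ V, w v * (c - f v) = 0 := by
      have h2 : ∑ v ∈ V, w v * f v = c := by
        rw [← hfx, ← hwx, map_sum]
        simp
      simp only [mul_sub, Finset.sum_sub_distrib, h2, ← Finset.sum_mul, hw1, one_mul, sub_self]
    have h2 := (Finset.sum_eq_zero_iff_of_nonneg fun v hv =>
      mul_nonneg (hw0 v hv) (sub_nonneg.2 (hf v hv))).1 h1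
    have h3 : ∀ v ∈ V, f v ≠ c → w v = 0 := fun v hv hne =>
      (mul_eq_zero.1 (h2 v hv)).resolve_right fun h => hne (sub_eq_zero.1 h).symm
    rw [show {v | v ∈ V ∧ f v = c} = (({v ∈ V | f v = c} : Finset E) : Set E) by
      ext v; simp, Finset.mem_convexHull']
    refine ⟨w, fun v hv => hw0 v (Finset.mem_filter.1 hv).1, ?_, ?_⟩
    · rw [Finset.sum_filter_of_ne, hw1]
      intro v hv hne
      by_contra hcon
      exact hne (h3 v hv hcon)
    · rw [Finset.sum_filter_of_ne, hwx]
      intro v hv hne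
      by_contra hcon
      exact hne (by rw [h3 v hv hcon, zero_smul])
  · refine convexHull_min (fun v hv => ⟨subset_convexHull ℝ _ hv.1, hv.2⟩) ?_
    exact (convex_convexHull ℝ _).inter (convex_hyperplane f.isLinear c)

/-- The homogenization of a point. -/
def homogenize (v : E) : E × ℝ := (v, 1)

lemma mem_coneFaces_homogenize {V S : Finset E} : S ∈ coneFaces homogenize V ↔
    S ⊆ V ∧ ∃ (f : E →ₗ[ℝ] ℝ) (c : ℝ), (∀ v ∈ V, f v ≤ c) ∧ ∀ v ∈ V, v ∈ S ↔ f v = c := by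
  rw [mem_coneFaces]
  refine and_congr_right fun _ => ⟨?_, ?_⟩
  · rintro ⟨g, hg, hgS⟩
    have key : ∀ v, g (homogenize v) = g (v, 0) + g (0, 1) := fun v => by
      rw [← map_add, homogenize, Prod.mk_add_mk, add_zero, zero_add]
    refine ⟨g ∘ₗ LinearMap.inl ℝ E ℝ, -g (0, 1), fun v hv => ?_, fun v hv => ?_⟩
    · have := hg v hv
      rw [key] at this
      rw [LinearMap.comp_apply, LinearMap.inl_apply]
      linarith
    · rw [hgS v hv, key, LinearMap.comp_apply, LinearMap.inl_apply, eq_neg_iff_add_eq_zero]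
  · rintro ⟨f, c, hf, hfS⟩
    refine ⟨f ∘ₗ LinearMap.fst ℝ E ℝ - c • LinearMap.snd ℝ E ℝ, fun v hv => ?_, fun v hv => ?_⟩
    · simpa [homogenize] using hf v hv
    · rw [hfS v hv]
      simp [homogenize, sub_eq_zero]

lemma empty_mem_coneFaces_homogenize (V : Finset E) : ∅ ∈ coneFaces homogenize V :=
  mem_coneFaces_homogenize.2 ⟨Finset.empty_subset V, 0, 1, by simp, by simp⟩

lemma finrank_span_homogenize [FiniteDimensional ℝ E] {S : Set E} (hS : S.Nonempty) :
    Module.finrank ℝ (Submodule.span ℝ (homogenize '' S)) =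
      Module.finrank ℝ (vectorSpan ℝ S) + 1 := by
  obtain ⟨p, hp⟩ := hS
  have h1 : Submodule.span ℝ (homogenize '' S) =
      (vectorSpan ℝ S).map (LinearMap.inl ℝ E ℝ) ⊔ Submodule.span ℝ {homogenize p} := by
    apply le_antisymm
    · rw [Submodule.span_le]
      rintro _ ⟨v, hv, rfl⟩
      rw [show homogenize v = LinearMap.inl ℝ E ℝ (v -ᵥ p) + homogenize p by simp [homogenize]]
      exact Submodule.add_mem_sup (Submodule.mem_map_of_mem (vsub_mem_vectorSpan ℝ hv hp))
        (Submodule.mem_span_singleton_self _)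
    · refine sup_le ?_ ?_
      · rw [vectorSpan_eq_span_vsub_set_right ℝ hp, Submodule.map_span, Submodule.span_le]
        rintro _ ⟨_, ⟨v, hv, rfl⟩, rfl⟩
        rw [show LinearMap.inl ℝ E ℝ (v -ᵥ p) = homogenize v - homogenize p by simp [homogenize]]
        exact Submodule.sub_mem _ (Submodule.subset_span ⟨v, hv, rfl⟩)
          (Submodule.subset_span ⟨p, hp, rfl⟩)
      · rw [Submodule.span_le, Set.singleton_subset_iff]
        exact Submodule.subset_span ⟨p, hp, rfl⟩
  have h2 : (vectorSpan ℝ S).map (LinearMap.inl ℝ E ℝ) ⊓ Submodule.span ℝ {homogenize p} = ⊥ := by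
    rw [eq_bot_iff]
    rintro _ ⟨⟨x, -, rfl⟩, hx⟩
    obtain ⟨c, hc⟩ := Submodule.mem_span_singleton.1 hx
    have h3 : c = 0 := by simpa [homogenize] using congrArg Prod.snd hc
    rw [← hc, h3, zero_smul]
    exact Submodule.zero_mem _
  have h3 := Submodule.finrank_sup_add_finrank_inf_eq
    ((vectorSpan ℝ S).map (LinearMap.inl ℝ E ℝ)) (Submodule.span ℝ {homogenize p})
  rw [← h1, h2, finrank_bot, add_zero, finrank_span_singleton
    (by simp [homogenize] : homogenize p ≠ 0)] at h3
  rw [h3, LinearEquiv.finrank_eq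
    (Submodule.equivMapOfInjective _ LinearMap.inl_injective (vectorSpan ℝ S)).symm]

end Polytope

section EuclideanPolytope

variable {N : ℕ} {P : Set (EuclideanSpace ℝ (Fin N))} {V S : Finset (EuclideanSpace ℝ (Fin N))}

lemma pdim_convexHull (S : Set (EuclideanSpace ℝ (Fin N))) :
    pdim (convexHull ℝ S) = Module.finrank ℝ (vectorSpan ℝ S) := by
  rw [pdim, affineSpan_convexHull, direction_affineSpan]

lemma convexHull_eq_of_mem_coneFaces (hS : S ∈ coneFaces homogenize V) :
    ∃ (f : EuclideanSpace ℝ (Fin N) →ₗ[ℝ] ℝ) (c : ℝ), (∀ v ∈ V, f v ≤ c) ∧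
      (∀ v ∈ V, v ∈ S ↔ f v = c) ∧
      convexHull ℝ (S : Set (EuclideanSpace ℝ (Fin N))) =
        {x ∈ convexHull ℝ (V : Set (EuclideanSpace ℝ (Fin N))) | f x = c} := by
  obtain ⟨hSV, f, c, hf, hfS⟩ := mem_coneFaces_homogenize.1 hS
  refine ⟨f, c, hf, hfS, ?_⟩
  rw [setOf_mem_convexHull_eq V f hf]
  congr 1
  ext v
  exact ⟨fun hv => ⟨hSV hv, (hfS v (hSV hv)).1 hv⟩, fun hv => (hfS v hv.1).2 hv.2⟩

lemma isFace_convexHull_iff {F : Set (EuclideanSpace ℝ (Fin N))} :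
    IsFace (convexHull ℝ (V : Set (EuclideanSpace ℝ (Fin N)))) F ↔
      ∃ S ∈ coneFaces homogenize V, convexHull ℝ (S : Set (EuclideanSpace ℝ (Fin N))) = F := by
  classical
  constructor
  · rintro ⟨f, c, hf, rfl⟩
    have hf' : ∀ v ∈ V, f v ≤ c := fun v hv => hf v (subset_convexHull ℝ _ hv)
    refine ⟨{v ∈ V | f v = c}, mem_coneFaces_homogenize.2 ⟨Finset.filter_subset _ _, f, c, hf',
      fun v hv => by simp [hv]⟩, ?_⟩
    rw [setOf_mem_convexHull_eq V f hf', Finset.coe_filter]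
  · rintro ⟨S, hS, rfl⟩
    obtain ⟨f, c, hf, -, he⟩ := convexHull_eq_of_mem_coneFaces hS
    exact ⟨f, c, fun x hx => convexHull_min (fun v hv => hf v hv)
      (convex_halfSpace_le f.isLinear c) hx, he⟩

lemma subset_of_convexHull_subset {T : Finset (EuclideanSpace ℝ (Fin N))}
    (hS : S ∈ coneFaces homogenize V) (hT : T ∈ coneFaces homogenize V)
    (h : convexHull ℝ (S : Set (EuclideanSpace ℝ (Fin N))) ⊆
      convexHull ℝ (T : Set (EuclideanSpace ℝ (Fin N)))) : S ⊆ T := by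
  intro v hv
  obtain ⟨f, c, -, hfT, he⟩ := convexHull_eq_of_mem_coneFaces hT
  rw [he] at h
  exact (hfT v ((mem_coneFaces.1 hS).1 hv)).2 (h (subset_convexHull ℝ _ hv)).2

/-- The faces of a polytope correspond to their sets of vertices. -/
lemma nonempty_coneFaces_orderIso (V : Finset (EuclideanSpace ℝ (Fin N))) :
    Nonempty ({F : Set (EuclideanSpace ℝ (Fin N)) //
        IsFace (convexHull ℝ (V : Set (EuclideanSpace ℝ (Fin N)))) F} ≃o
      {S : Finset (EuclideanSpace ℝ (Fin N)) // S ∈ coneFaces homogenize V ∧ S ⊆ V}) := by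
  let g : {S : Finset (EuclideanSpace ℝ (Fin N)) // S ∈ coneFaces homogenize V ∧ S ⊆ V} ↪o
      {F : Set (EuclideanSpace ℝ (Fin N)) //
        IsFace (convexHull ℝ (V : Set (EuclideanSpace ℝ (Fin N)))) F} :=
    OrderEmbedding.ofMapLEIff
      (fun S => ⟨convexHull ℝ (S.1 : Set _), isFace_convexHull_iff.2 ⟨S.1, S.2.1, rfl⟩⟩)
      fun S T => ⟨fun h => subset_of_convexHull_subset S.2.1 T.2.1 h,
        fun h => convexHull_mono (Finset.coe_subset.2 h)⟩
  refine ⟨(RelIso.ofSurjective g ?_).symm⟩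
  rintro ⟨F, hF⟩
  obtain ⟨S, hS, rfl⟩ := isFace_convexHull_iff.1 hF
  exact ⟨⟨S, hS, (mem_coneFaces.1 hS).1⟩, rfl⟩

lemma fCount_convexHull (k : ℕ) :
    fCount (convexHull ℝ (V : Set (EuclideanSpace ℝ (Fin N)))) k =
      ((coneFaces homogenize V).filter fun S : Finset (EuclideanSpace ℝ (Fin N)) =>
        Module.finrank ℝ (Submodule.span ℝ
          (homogenize '' (S : Set (EuclideanSpace ℝ (Fin N))))) = k + 1).card := by
  rw [fCount, ← Set.ncard_coe_finset, ← Set.InjOn.ncard_image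
    (f := fun S : Finset _ => convexHull ℝ (S : Set (EuclideanSpace ℝ (Fin N))))]
  · congr 1
    ext F
    simp only [Set.mem_ofPred_eq, Set.mem_image, Finset.coe_filter, isFace_convexHull_iff]
    constructor
    · rintro ⟨⟨S, hS, rfl⟩, hne, hd⟩
      rw [pdim_convexHull] at hd
      exact ⟨S, ⟨hS, by rw [finrank_span_homogenize (convexHull_nonempty_iff.1 hne), hd]⟩, rfl⟩
    · rintro ⟨S, ⟨hS, hd⟩, rfl⟩
      have hne : (S : Set (EuclideanSpace ℝ (Fin N))).Nonempty := by
        rw [Set.nonempty_iff_ne_empty]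
        intro h
        rw [h, Set.image_empty, Submodule.span_empty, finrank_bot] at hd
        omega
      rw [finrank_span_homogenize hne] at hd
      exact ⟨⟨S, hS, rfl⟩, hne.convexHull, by rw [pdim_convexHull]; omega⟩
  · intro S hS T hT h
    have hS' := (Finset.mem_filter.1 hS).1
    have hT' := (Finset.mem_filter.1 hT).1
    exact (subset_of_convexHull_subset hS' hT' h.subset).antisymm
      (subset_of_convexHull_subset hT' hS' h.superset)

lemma IsPolytope.exists_vertices (hP : IsPolytope P) :
    ∃ V : Finset (EuclideanSpace ℝ (Fin N)), P = convexHull ℝ (V : Set _) ∧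
      vertexSet P = V ∧ ∀ v ∈ V, {v} ∈ coneFaces homogenize V := by
  obtain ⟨V₀, rfl⟩ := hP
  set P := convexHull ℝ (V₀ : Set (EuclideanSpace ℝ (Fin N))) with hP
  have hfin : (P.extremePoints ℝ).Finite :=
    V₀.finite_toSet.subset extremePoints_convexHull_subset
  obtain ⟨V, hV⟩ := hfin.exists_finset_coe
  have hPV : P = convexHull ℝ (V : Set (EuclideanSpace ℝ (Fin N))) := by
    have := closure_convexHull_extremePoints (V₀.finite_toSet.isCompact_convexHull ℝ)
      (convex_convexHull ℝ _)
    rw [(hfin.isClosed_convexHull ℝ).closure_eq, ← hV] at this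
    exact this.symm
  have hvert : ∀ v ∈ V, {v} ∈ coneFaces homogenize V := by
    intro v hv
    have hv' : v ∈ P.extremePoints ℝ := hV ▸ hv
    have h1 := ((convex_convexHull ℝ _).mem_extremePoints_iff_convex_sdiff.1 hv').2
    have h2 : v ∉ convexHull ℝ ((V : Set _) \ {v}) := fun h =>
      (convexHull_min (Set.sdiff_subset_sdiff_left (hV ▸ extremePoints_subset)) h1 h).2 rfl
    obtain ⟨f, u, hfv, hfu⟩ := geometric_hahn_banach_point_closed (convex_convexHull ℝ _)
      ((V.finite_toSet.subset Set.sdiff_subset).isClosed_convexHull ℝ) h2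
    have h3 : ∀ w ∈ V, w ≠ v → f v < f w := fun w hw hne =>
      hfv.trans (hfu w (subset_convexHull ℝ _ ⟨hw, hne⟩))
    refine mem_coneFaces_homogenize.2 ⟨Finset.singleton_subset_iff.2 hv, -f.toLinearMap, -f v,
      fun w hw => ?_, fun w hw => ?_⟩
    · by_cases hne : w = v
      · rw [hne]; rfl
      · exact neg_le_neg (h3 w hw hne).le
    · rw [Finset.mem_singleton]
      refine ⟨fun h => h ▸ rfl, fun h => ?_⟩
      by_contra hne
      exact (h3 w hw hne).ne (neg_injective h).symm
  refine ⟨V, hPV, ?_, hvert⟩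
  ext v
  rw [vertexSet, Set.mem_ofPred_eq, hPV, isFace_convexHull_iff]
  constructor
  · rintro ⟨S, hS, h⟩
    have hne : (S : Set (EuclideanSpace ℝ (Fin N))).Nonempty := by
      rw [← convexHull_nonempty_iff (𝕜 := ℝ), h]
      exact Set.singleton_nonempty v
    obtain ⟨w, hw⟩ := hne
    have h1 : w ∈ ({v} : Set _) := h ▸ subset_convexHull ℝ _ hw
    rw [Set.mem_singleton_iff] at h1
    exact h1 ▸ (mem_coneFaces.1 hS).1 hw
  · intro hv
    exact ⟨{v}, hvert v hv, by simp⟩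

end EuclideanPolytope

lemma nonempty_orderIso_bipyramidFaces {N : ℕ} {P : Set (EuclideanSpace ℝ (Fin N))} {d s k : ℕ}
    (hP : IsPolytope P) (hdim : pdim P = d) (hvert : (vertexSet P).ncard = d + s)
    (hs : 2 ≤ s) (hsd : s ≤ d) (hk1 : 1 ≤ k) (hk2 : k ≤ d - 2)
    (heq : (fCount P k : ℤ) = phi d s k) :
    Nonempty ({F : Set (EuclideanSpace ℝ (Fin N)) // IsFace P F} ≃o
      (bipyramidFaces s (d - s))ᵒᵈ) := by
  classical
  obtain ⟨V, rfl, hV, hV1⟩ := hP.exists_vertices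
  rw [hV, Set.ncard_coe_finset] at hvert
  let L := coneFaceSystem homogenize V (empty_mem_coneFaces_homogenize V) hV1
  have hLV : V ∈ L.faces := self_mem_coneFaces
  have hrank : L.rank V = d + 1 := by
    have hne : (V : Set (EuclideanSpace ℝ (Fin N))).Nonempty := by
      rw [Finset.coe_nonempty, ← Finset.card_pos]
      omega
    rw [pdim_convexHull] at hdim
    rw [← hdim]
    exact finrank_span_homogenize hne
  have hcount : fCount (convexHull ℝ (V : Set (EuclideanSpace ℝ (Fin N)))) k =
      (L.interval ∅ V (k + 1)).card := by
    rw [fCount_convexHull]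
    congr 1
    ext S
    rw [Finset.mem_filter, FaceSystem.mem_interval]
    exact ⟨fun h => ⟨h.1, Finset.empty_subset S, (mem_coneFaces.1 h.1).1, h.2⟩,
      fun h => ⟨h.1, h.2.2.2⟩⟩
  have hT : L.IsTight V := by
    refine FaceSystem.isTight_of_grunbaum_eq hLV (by omega) (by omega) hk1 (by omega) ?_
    rw [hcount, phi, C, C, C, if_neg (by omega), if_neg (by omega), if_neg (by omega),
      show ((d : ℤ) + 1).toNat = d + 1 by omega, show (d : ℤ).toNat = d by omega,
      show ((d : ℤ) + 1 - s).toNat = d + 1 - s by omega] at heq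
    rw [hrank, hvert, show 2 * (d + 1) - 1 - (d + s) = d + 1 - s by omega,
      show d + 1 - 1 = d by omega]
    omega
  obtain ⟨φ, h1, h2, h3, h4, h5⟩ := hT.exists_labeling hrank hvert hsd
  obtain ⟨e⟩ := nonempty_coneFaces_orderIso V
  obtain ⟨e'⟩ := L.nonempty_orderIso hLV φ h1 h2 h3 h4 h5
  exact ⟨e.trans e'⟩

section Model

variable {E : Type*} [AddCommGroup E] [Module ℝ E]

lemma notMem_affineSpan_convexHull {A : Set E} {x : E} (f : E →ₗ[ℝ] ℝ) (hA : ∀ a ∈ A, f a = 0)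
    (hx : f x ≠ 0) : x ∉ affineSpan ℝ (convexHull ℝ A) := by
  rw [affineSpan_convexHull]
  intro h
  have hle : Submodule.span ℝ A ≤ LinearMap.ker f := Submodule.span_le.2 fun a ha => hA a ha
  exact hx (hle (affineSpan_subset_span h))

lemma convexHull_convexHull_union (A B : Set E) :
    convexHull ℝ (convexHull ℝ A ∪ B) = convexHull ℝ (A ∪ B) := by
  refine subset_antisymm (convexHull_min (union_subset (convexHull_mono subset_union_left)
    (subset_union_right.trans (subset_convexHull ℝ _))) (convex_convexHull ℝ _))
    (convexHull_mono (union_subset_union_left B (subset_convexHull ℝ A)))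

lemma isFoldPyramid_convexHull {N : ℕ} {ι : Type*} [DecidableEq ι]
    {A : Set (EuclideanSpace ℝ (Fin N))} (a : ι → EuclideanSpace ℝ (Fin N))
    (g : ι → EuclideanSpace ℝ (Fin N) →ₗ[ℝ] ℝ) (hA : ∀ i, ∀ x ∈ A, g i x = 0)
    (hone : ∀ i, g i (a i) ≠ 0) (hzero : ∀ i k, i ≠ k → g i (a k) = 0) (T : Finset ι) :
    IsFoldPyramid T.card (convexHull ℝ (A ∪ a '' T)) (convexHull ℝ A) := by
  induction T using Finset.induction_on with
  | empty => simp [IsFoldPyramid]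
  | insert i T hi ih =>
    rw [Finset.card_insert_of_notMem hi]
    refine ⟨_, ih, a i, notMem_affineSpan_convexHull (g i) ?_ (hone i), ?_⟩
    · rintro x (hx | ⟨k, hk, rfl⟩)
      · exact hA i x hx
      · exact hzero i k fun h => hi (h ▸ hk)
    · rw [insert_eq (a i) (convexHull ℝ _), union_comm {a i}, convexHull_convexHull_union,
        union_assoc, Finset.coe_insert, image_insert_eq, union_singleton]

lemma sum_smul_mem_intrinsicInterior {ι κ : Type*} [Fintype ι] {N : ℕ}
    (b : Module.Basis κ ℝ (EuclideanSpace ℝ (Fin N))) {j : ι → κ} (hj : Function.Injective j)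
    {w : ι → ℝ} (hw : ∀ i, 0 < w i) (hw1 : ∑ i, w i = 1) :
    ∑ i, w i • b (j i) ∈ intrinsicInterior ℝ (convexHull ℝ (range fun i => b (j i))) := by
  classical
  have hcoord : ∀ (v : ι → ℝ) i, b.coord (j i) (∑ k, v k • b (j k)) = v i := by
    intro v i
    rw [map_sum, Finset.sum_eq_single i]
    · simp
    · intro k _ hk
      simp [hj.ne hk]
    · simp
  have hmem : ∀ v : ι → ℝ, (∀ i, 0 < v i) → ∑ i, v i = 1 →
      ∑ i, v i • b (j i) ∈ convexHull ℝ (range fun i => b (j i)) := fun v hv hv1 =>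
    (convex_convexHull ℝ _).sum_mem (fun i _ => (hv i).le) hv1
      fun i _ => subset_convexHull ℝ _ (mem_range_self i)
  rw [mem_intrinsicInterior]
  refine ⟨⟨_, subset_affineSpan ℝ _ (hmem w hw hw1)⟩, ?_, rfl⟩
  rw [mem_interior]
  refine ⟨{y | ∀ i, 0 < b.coord (j i) y}, ?_, ?_, ?_⟩
  · rintro ⟨y, hy⟩ hpos
    rw [affineSpan_convexHull] at hy
    obtain ⟨v, hv1, hyv⟩ := eq_affineCombination_of_mem_affineSpan_of_fintype hy
    rw [Finset.affineCombination_eq_linear_combination _ _ _ hv1] at hyv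
    change ∀ i, 0 < b.coord (j i) y at hpos
    change y ∈ convexHull ℝ _
    rw [hyv] at hpos ⊢
    exact hmem v (fun i => hcoord v i ▸ hpos i) hv1
  · rw [ofPred_forall]
    exact isOpen_iInter_of_finite fun i => isOpen_lt continuous_const
      ((LinearMap.continuous_of_finiteDimensional _).comp continuous_subtype_val)
  · intro i
    rw [hcoord]
    exact hw i

variable {s r : ℕ}

/-- The vertices of the `r`-fold pyramid over the bipyramid over an `(s - 1)`-simplex, in terms of
a basis of the ambient space. -/
noncomputable def bipyramidVertex (b : Module.Basis (Unit ⊕ Fin s ⊕ Fin r) ℝ E) :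
    Bool ⊕ Fin s ⊕ Fin r → E
  | .inl true => b (.inl ())
  | .inl false => (2 / s : ℝ) • ∑ i, b (.inr (.inl i)) - b (.inl ())
  | .inr z => b (.inr z)

variable (b : Module.Basis (Unit ⊕ Fin s ⊕ Fin r) ℝ E)

lemma mem_bipyramidFaces_iff (hs : 0 < s) (G : Set (Bool ⊕ Fin s ⊕ Fin r)) :
    G ∈ bipyramidFaces s r ↔ ∃ (f : E →ₗ[ℝ] ℝ) (c : ℝ), (∀ a, f (bipyramidVertex b a) ≤ c) ∧
      ∀ a, a ∈ G ↔ f (bipyramidVertex b a) = c := by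
  classical
  have hs' : (0 : ℝ) < s := by exact_mod_cast hs
  constructor
  · intro hG
    change (∀ t, Sum.inl t ∈ G) ↔ ∀ i, Sum.inr (Sum.inl i) ∈ G at hG
    rw [Bool.forall_bool] at hG
    set h : Fin s ⊕ Fin r → ℝ := fun z => if Sum.inr z ∈ G then 0 else -1 with hh
    set m : ℝ := (2 / s : ℝ) * ∑ i, h (.inl i) with hm
    have hle : ∀ z, h z ≤ 0 := by
      intro z
      simp only [hh]
      split_ifs <;> norm_num
    have hzero : ∀ z, Sum.inr z ∈ G ↔ h z = 0 := by
      intro z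
      simp only [hh]
      split_ifs <;> simp_all
    have hm0 : m ≤ 0 := mul_nonpos_of_nonneg_of_nonpos (by positivity)
      (Finset.sum_nonpos fun i _ => hle _)
    have hm1 : m = 0 ↔ ∀ i, Sum.inr (Sum.inl i) ∈ G := by
      rw [hm, mul_eq_zero, or_iff_right (by positivity),
        Finset.sum_eq_zero_iff_of_nonpos fun i _ => hle _]
      simp [hzero]
    rw [← hm1] at hG
    set u : ℝ := if Sum.inl true ∈ G then 0 else if Sum.inl false ∈ G then m else m / 2 with hu
    let f : E →ₗ[ℝ] ℝ := b.constr ℝ (Sum.elim (fun _ => u) h)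
    have hfu : f (bipyramidVertex b (.inl true)) = u := by
      simp [f, bipyramidVertex]
    have hfv : f (bipyramidVertex b (.inl false)) = m - u := by
      rw [bipyramidVertex, map_sub, map_smul, map_sum, hm]
      simp [f]
    have hfz : ∀ z, f (bipyramidVertex b (.inr z)) = h z := by
      intro z
      simp [f, bipyramidVertex]
    refine ⟨f, 0, ?_, ?_⟩
    · rintro ((_ | _) | z)
      · rw [hfv, hu]
        split_ifs <;> linarith
      · rw [hfu, hu]
        split_ifs <;> linarith
      · rw [hfz]
        exact hle z
    · rintro ((_ | _) | z)
      · rw [hfv, hu]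
        split_ifs <;> grind
      · rw [hfu, hu]
        split_ifs <;> grind
      · rw [hfz]
        exact hzero z
  · rintro ⟨f, c, hle, hG⟩
    change (∀ t, Sum.inl t ∈ G) ↔ ∀ i, Sum.inr (Sum.inl i) ∈ G
    have hsum : f (bipyramidVertex b (.inl true)) + f (bipyramidVertex b (.inl false)) =
        (2 / s : ℝ) * ∑ i, f (bipyramidVertex b (.inr (.inl i))) := by
      simp [bipyramidVertex]
    have key : ∀ i, f (bipyramidVertex b (.inr (.inl i))) ≤ c := fun i => hle _
    have hcs : ∑ _i : Fin s, c = s * c := by simp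
    simp only [hG, Bool.forall_bool]
    constructor
    · rintro ⟨h1, h2⟩ i
      have h3 : ∑ i, f (bipyramidVertex b (.inr (.inl i))) = ∑ _i : Fin s, c := by
        rw [h1, h2] at hsum
        rw [hcs]
        field_simp at hsum
        linarith
      exact (Finset.sum_eq_sum_iff_of_le fun i _ => key i).1 h3 i (Finset.mem_univ i)
    · intro h
      rw [Finset.sum_congr rfl fun i _ => h i, hcs,
        show (2 / s : ℝ) * (s * c) = 2 * c by field_simp] at hsum
      have h1 := hle (.inl true)
      have h2 := hle (.inl false)
      constructor <;> linarith

lemma bipyramidVertex_injective : Function.Injective (bipyramidVertex b) := by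
  have key : ∀ t z, bipyramidVertex b (.inl t) ≠ bipyramidVertex b (.inr z) := by
    intro t z h
    have := congrArg (b.coord (.inl ())) h
    cases t <;> simp [bipyramidVertex] at this
  have key2 : bipyramidVertex b (.inl true) ≠ bipyramidVertex b (.inl false) := by
    intro h
    have := congrArg (b.coord (.inl ())) h
    simp [bipyramidVertex] at this
    linarith
  rintro ((_ | _) | z) ((_ | _) | z') h
  · rfl
  · exact absurd h.symm key2
  · exact absurd h (key _ _)
  · exact absurd h key2
  · rfl
  · exact absurd h (key _ _)
  · exact absurd h.symm (key _ _)
  · exact absurd h.symm (key _ _)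
  · exact congrArg _ (Sum.inr_injective (b.injective h))

end Model

lemma nonempty_orderIso_convexHull_bipyramidVertex {N s r : ℕ} (hs : 0 < s)
    (b : Module.Basis (Unit ⊕ Fin s ⊕ Fin r) ℝ (EuclideanSpace ℝ (Fin N))) :
    Nonempty ({F // IsFace (convexHull ℝ (range (bipyramidVertex b))) F} ≃o
      bipyramidFaces s r) := by
  classical
  set p := bipyramidVertex b with hp
  have hV : range p = ((Finset.univ.image p : Finset _) : Set (EuclideanSpace ℝ (Fin N))) := by
    simp
  have hinj : Function.Injective p := bipyramidVertex_injective b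
  rw [hV]
  obtain ⟨e⟩ := nonempty_coneFaces_orderIso (Finset.univ.image p)
  have hmem : ∀ G : Finset (Bool ⊕ Fin s ⊕ Fin r),
      G.image p ∈ coneFaces homogenize (Finset.univ.image p) ↔
        (G : Set _) ∈ bipyramidFaces s r := by
    intro G
    rw [mem_bipyramidFaces_iff b hs, mem_coneFaces_homogenize]
    simp only [Finset.forall_mem_image, Finset.mem_univ, true_imp_iff, hinj.mem_finset_image,
      Finset.mem_coe, Finset.image_subset_image (Finset.subset_univ G), true_and, ← hp]
  have hpre : ∀ S : Finset (EuclideanSpace ℝ (Fin N)), S ⊆ Finset.univ.image p →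
      Finset.image p {a | p a ∈ S} = S := by
    intro S hS
    ext v
    constructor
    · intro hv
      obtain ⟨a, ha, rfl⟩ := Finset.mem_image.1 hv
      simpa using ha
    · intro hv
      obtain ⟨a, -, rfl⟩ := Finset.mem_image.1 (hS hv)
      exact Finset.mem_image_of_mem p (by simpa using hv)
  let e' : {S : Finset (EuclideanSpace ℝ (Fin N)) //
      S ∈ coneFaces homogenize (Finset.univ.image p) ∧ S ⊆ Finset.univ.image p} ≃o
        bipyramidFaces s r :=
    { toFun := fun S => ⟨(({a | p a ∈ S.1} : Finset _) : Set _),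
        (hmem _).1 ((hpre S.1 S.2.2).symm ▸ S.2.1)⟩
      invFun := fun G => ⟨G.1.toFinset.image p, (hmem _).2 (by simp),
        Finset.image_subset_image (Finset.subset_univ _)⟩
      left_inv := fun S => Subtype.ext (by simpa using hpre S.1 S.2.2)
      right_inv := fun G => Subtype.ext (by ext a; simp [hinj.eq_iff])
      map_rel_iff' := by
        rintro ⟨S, hS⟩ ⟨T, hT⟩
        simp only [Equiv.coe_fn_mk, Subtype.mk_le_mk, Finset.coe_subset]
        refine ⟨fun h => ?_, fun h a => by simpa using @h (p a)⟩
        rw [← hpre S hS.2, ← hpre T hT.2]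
        exact Finset.image_subset_image h }
  exact ⟨e.trans e'⟩

lemma exists_isFoldPyramid_isBipyramid {s : ℕ} (r : ℕ) (hs : 0 < s) :
    ∃ (M : ℕ) (S B Q : Set (EuclideanSpace ℝ (Fin M))), IsSimplex S (s - 1) ∧ IsBipyramid B S ∧
      IsFoldPyramid r Q B ∧ Nonempty ({F // IsFace Q F} ≃o bipyramidFaces s r) := by
  classical
  let b : Module.Basis (Unit ⊕ Fin s ⊕ Fin r) ℝ
      (EuclideanSpace ℝ (Fin (Fintype.card (Unit ⊕ Fin s ⊕ Fin r)))) :=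
    (EuclideanSpace.basisFun _ ℝ).toBasis.reindex (Fintype.equivFin _).symm
  have hs' : (0 : ℝ) < s := by exact_mod_cast hs
  let j : Fin s → Unit ⊕ Fin s ⊕ Fin r := fun i => .inr (.inl i)
  have hj : Function.Injective j := Sum.inr_injective.comp Sum.inl_injective
  let A := range fun i => b (j i)
  let x := bipyramidVertex b (.inl true)
  let y := bipyramidVertex b (.inl false)
  have hA0 : ∀ v ∈ A, b.coord (.inl ()) v = 0 := by
    rintro _ ⟨i, rfl⟩
    simp [j]
  refine ⟨_, convexHull ℝ A, convexHull ℝ (A ∪ {x, y}),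
    convexHull ℝ (range (bipyramidVertex b)), ?_, ?_, ?_,
    nonempty_orderIso_convexHull_bipyramidVertex hs b⟩
  · refine ⟨Finset.univ.image fun i => b (j i), ?_, ?_, by simp [A]⟩
    · rw [Finset.card_image_of_injective _ fun _ _ h => hj (b.injective h), Finset.card_univ,
        Fintype.card_fin]
      omega
    · have h := (b.linearIndependent.comp j hj).affineIndependent.range
      have he : range (b ∘ j) = ((Finset.univ.image fun i => b (j i) : Finset _) : Set _) := by
        simp [Function.comp_def]
      rw [he] at h
      exact h
  · refine ⟨x, y, notMem_affineSpan_convexHull (b.coord (.inl ())) hA0 ?_,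
      notMem_affineSpan_convexHull (b.coord (.inl ())) hA0 ?_,
      ⟨∑ i, (s : ℝ)⁻¹ • b (j i), ?_, ?_⟩, ?_⟩
    · simp [x, bipyramidVertex]
    · simp [y, bipyramidVertex]
    · convert midpoint_mem_openSegment (𝕜 := ℝ) x y using 1
      rw [midpoint_eq_smul_add, ← Finset.smul_sum]
      simp only [x, y, bipyramidVertex, add_sub_cancel, smul_smul, j]
      congr 1
      simp
      field_simp
    · exact sum_smul_mem_intrinsicInterior b hj (fun _ => inv_pos.2 hs') (by simp [hs'.ne'])
    · rw [convexHull_convexHull_union]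
  · have h := isFoldPyramid_convexHull (A := A ∪ {x, y})
      (fun t : Fin r => b (.inr (.inr t))) (fun t => b.coord (.inr (.inr t))) ?_ ?_ ?_ Finset.univ
    · convert h using 2
      · simp
      · ext v
        simp only [mem_range, mem_union, A, j, x, y, Sum.exists, Bool.exists_bool]
        simp [bipyramidVertex]
        grind
    · rintro t v (⟨i, rfl⟩ | rfl | rfl)
      · simp [j]
      · simp [x, bipyramidVertex]
      · simp [y, bipyramidVertex]
    · simp
    · intro t u htu
      simp [htu.symm]

theorem stmt9 {N : ℕ} (P : Set (EuclideanSpace ℝ (Fin N))) (d s k : ℕ)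
    (hP : IsPolytope P) (hdim : pdim P = d)
    (hvert : (vertexSet P).ncard = d + s)
    (hs : 2 ≤ s) (hsd : s ≤ d) (hk1 : 1 ≤ k) (hk2 : k ≤ d - 2)
    (heq : (fCount P k : ℤ) = phi d s k) :
    ∃ (M : ℕ) (S B Q : Set (EuclideanSpace ℝ (Fin M))),
      IsSimplex S (s - 1) ∧ IsBipyramid B S ∧ IsFoldPyramid (d - s) Q B ∧
        DualCombEquiv P Q := by
  obtain ⟨M, S, B, Q, hS, hB, hQ, ⟨e⟩⟩ :=
    exists_isFoldPyramid_isBipyramid (d - s) (by omega : 0 < s)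
  obtain ⟨e'⟩ := nonempty_orderIso_bipyramidFaces hP hdim hvert hs hsd hk1 hk2 heq
  exact ⟨M, S, B, Q, hS, hB, hQ, ⟨e'.trans e.symm.dual⟩⟩
end

section
/- For all d ≥ s ≥ 2 and 1 ≤ k ≤ d-1, the polytope (T^{d,d-s}_1)* (dual of the (d-s)-fold pyramid over the bipyramid over an (s-1)-simplex) satisfies f_k = φ_k(d+s,d) = C(d+1,k+1) + C(d,k+1) - C(d+1-s,k+1). -/
open Set

section AffineGeometry

variable {E : Type*} [AddCommGroup E] [Module ℝ E]

/-- A face of the convex hull of `W` is the convex hull of the points of `W` where the inequality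
defining it is tight. -/
theorem convexHull_inter_hyperplane_eq (W : Finset E) (f : E →ₗ[ℝ] ℝ) (c : ℝ)
    (hf : ∀ p ∈ W, f p ≤ c) :
    {z ∈ convexHull ℝ (W : Set E) | f z = c} = convexHull ℝ {p : E | p ∈ W ∧ f p = c} := by
  apply Set.Subset.antisymm
  · rintro z ⟨hz, hzc⟩
    obtain ⟨w, hw0, hw1, rfl⟩ := Finset.mem_convexHull'.1 hz
    have hsum : ∑ p ∈ W, w p * (c - f p) = 0 := by
      simp only [mul_sub, Finset.sum_sub_distrib, ← Finset.sum_mul, hw1, one_mul]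
      rw [← hzc]
      simp
    have hzero : ∀ p ∈ W, w p * (c - f p) = 0 :=
      (Finset.sum_eq_zero_iff_of_nonneg fun p hp =>
        mul_nonneg (hw0 p hp) (sub_nonneg.2 (hf p hp))).1 hsum
    have hsupp : ∀ p ∈ W, f p ≠ c → w p = 0 := fun p hp hne =>
      (mul_eq_zero.1 (hzero p hp)).resolve_right fun h => hne (sub_eq_zero.1 h).symm
    classical
    have hset : {p : E | p ∈ W ∧ f p = c} = ((W.filter fun p => f p = c : Finset E) : Set E) := by
      ext; simp
    rw [hset]
    refine Finset.mem_convexHull'.2 ⟨w, fun p hp => hw0 p (Finset.mem_filter.1 hp).1, ?_, ?_⟩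
    · rw [← hw1]
      refine Finset.sum_filter_of_ne fun p hp h => ?_
      by_contra hne
      exact h (hsupp p hp hne)
    · refine Finset.sum_filter_of_ne fun p hp h => ?_
      by_contra hne
      exact h (by rw [hsupp p hp hne, zero_smul])
  · refine convexHull_min (fun p hp => ⟨subset_convexHull ℝ _ hp.1, hp.2⟩) ?_
    exact (convex_convexHull ℝ _).inter (convex_hyperplane f.isLinear c)

/-- An affine function takes arbitrary prescribed values on an affinely independent set. -/
theorem exists_affine_eq_of_affineIndependent {s : Set E}
    (hs : AffineIndependent ℝ (Subtype.val : s → E)) (g : E → ℝ) :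
    ∃ (f : E →ₗ[ℝ] ℝ) (c : ℝ), ∀ p ∈ s, c - f p = g p := by
  rcases s.eq_empty_or_nonempty with rfl | ⟨p₀, hp₀⟩
  · exact ⟨0, 0, by simp⟩
  have hli : LinearIndepOn ℝ id ((fun p => (p -ᵥ p₀ : E)) '' (s \ {p₀})) :=
    (affineIndependent_set_iff_linearIndependent_vsub ℝ hp₀).1 hs
  let b := Module.Basis.extend (K := ℝ) hli
  let f : E →ₗ[ℝ] ℝ := b.constr ℝ fun v => g p₀ - g ((v : E) + p₀)
  refine ⟨f, g p₀ + f p₀, fun p hp => ?_⟩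
  rcases eq_or_ne p p₀ with rfl | hne
  · simp
  have hmem : p - p₀ ∈ (fun p => (p -ᵥ p₀ : E)) '' (s \ {p₀}) := ⟨p, ⟨hp, hne⟩, rfl⟩
  have hv := Module.Basis.subset_extend hli hmem
  have hfv : f (b ⟨p - p₀, hv⟩) = g p₀ - g p := by
    simp [f, Module.Basis.constr_basis]
  rw [Module.Basis.extend_apply_self, map_sub] at hfv
  linarith

theorem affineIndependent_insert_of_notMem_affineSpan {s : Set E} {z : E}
    (hs : AffineIndependent ℝ (Subtype.val : s → E)) (hz : z ∉ affineSpan ℝ s) :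
    AffineIndependent ℝ (Subtype.val : ↥(insert z s : Set E) → E) := by
  have hzs : z ∉ s := fun h => hz (subset_affineSpan ℝ s h)
  refine AffineIndependent.affineIndependent_of_notMem_span (i := ⟨z, Set.mem_insert z s⟩) ?_ ?_
  · refine hs.comp_embedding (f := ⟨fun p : {p : ↥(insert z s) // p ≠ ⟨z, Set.mem_insert z s⟩} =>
      (⟨p.1.1, p.1.2.resolve_left fun h => p.2 (Subtype.ext h)⟩ : s), fun p q h => ?_⟩)
    exact Subtype.ext (Subtype.ext (congrArg (fun r : s => (r : E)) h))
  · refine fun h => hz (affineSpan_mono ℝ ?_ h)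
    rintro _ ⟨p, hp, rfl⟩
    exact p.2.resolve_left fun h => hp (Subtype.ext h)

theorem finrank_direction_affineSpan_add_one {U : Finset E} (hne : U.Nonempty)
    (hU : AffineIndependent ℝ (Subtype.val : ↥(U : Set E) → E)) :
    Module.finrank ℝ (affineSpan ℝ (U : Set E)).direction + 1 = U.card := by
  have : Nonempty (U : Set E) := hne.to_subtype
  have h := hU.finrank_vectorSpan_add_one
  rw [Subtype.range_coe] at h
  rw [direction_affineSpan, h]
  simp

end AffineGeometry

/-- A linear function attaining its maximum over `S` at a relative interior point is constant
on `S`. -/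
theorem eq_of_isMax_of_mem_intrinsicInterior {E : Type*} [NormedAddCommGroup E]
    [NormedSpace ℝ E] {S : Set E} {q : E} (hq : q ∈ intrinsicInterior ℝ S) (f : E →ₗ[ℝ] ℝ)
    (c : ℝ) (hf : ∀ z ∈ S, f z ≤ c) (hfq : f q = c) {v : E} (hv : v ∈ S) : f v = c := by
  obtain ⟨y, hy, rfl⟩ := mem_intrinsicInterior.1 hq
  let γ : ℝ → affineSpan ℝ S := fun t =>
    ⟨AffineMap.lineMap (y : E) v t, AffineMap.lineMap_mem t y.2 (subset_affineSpan ℝ S hv)⟩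
  have hγ : Continuous γ := AffineMap.lineMap_continuous.subtype_mk _
  have h0 : γ 0 = y := Subtype.ext (by simp [γ])
  have hnear : ∀ᶠ t in nhds (0 : ℝ), γ t ∈ ((↑) ⁻¹' S : Set (affineSpan ℝ S)) :=
    hγ.continuousAt.eventually_mem (h0 ▸ mem_interior_iff_mem_nhds.1 hy)
  obtain ⟨ε, hε, hball⟩ := Metric.eventually_nhds_iff.1 hnear
  have hmem : AffineMap.lineMap (y : E) v (-(ε / 2)) ∈ S :=
    hball (by rw [Real.dist_eq, sub_zero, abs_neg, abs_of_pos (by positivity)]; linarith)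
  have h1 := hf _ hmem
  rw [AffineMap.lineMap_apply] at h1
  simp only [vsub_eq_sub, vadd_eq_add, map_add, map_smul, map_sub, smul_eq_mul, hfq] at h1
  have h2 := hf v hv
  nlinarith

/-- `V`, `A`, `x`, `y` are the vertices of an iterated pyramid over a bipyramid: `V` is the vertex
set of the simplex, `x` and `y` are the apices of the bipyramid, whose segment meets the simplex
in `q`, and `A` is the set of apices of the pyramids. -/
structure IsBipyramidJoin {E : Type*} [NormedAddCommGroup E] [NormedSpace ℝ E]
    (V A : Finset E) (x y q : E) : Prop where
  disjoint : Disjoint V A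
  left_notMem : x ∉ (V ∪ A : Set E)
  right_notMem : y ∉ (V ∪ A : Set E)
  ne : x ≠ y
  indep_left : AffineIndependent ℝ (Subtype.val : ↥(insert x (V ∪ A) : Set E) → E)
  indep_right : AffineIndependent ℝ (Subtype.val : ↥(insert y (V ∪ A) : Set E) → E)
  mem_openSegment : q ∈ openSegment ℝ x y
  mem_intrinsicInterior : q ∈ intrinsicInterior ℝ (convexHull ℝ (V : Set E))

namespace IsBipyramidJoin

variable {E : Type*} [NormedAddCommGroup E] [NormedSpace ℝ E] {V A : Finset E} {x y q : E}

theorem mem_convexHull (h : IsBipyramidJoin V A x y q) : q ∈ convexHull ℝ (V : Set E) :=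
  intrinsicInterior_subset h.mem_intrinsicInterior

theorem tight_apices_iff (h : IsBipyramidJoin V A x y q) (f : E →ₗ[ℝ] ℝ) (c : ℝ)
    (hV : ∀ v ∈ V, f v ≤ c) (hx : f x ≤ c) (hy : f y ≤ c) :
    (f x = c ∧ f y = c) ↔ ∀ v ∈ V, f v = c := by
  obtain ⟨a, b, ha, hb, hab, hq⟩ := h.mem_openSegment
  have hfq : f q = a * f x + b * f y := by simp [← hq]
  constructor
  · rintro ⟨hxc, hyc⟩ v hv
    refine eq_of_isMax_of_mem_intrinsicInterior h.mem_intrinsicInterior f c ?_ ?_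
      (subset_convexHull ℝ _ hv)
    · exact convexHull_min hV (convex_halfSpace_le f.isLinear c)
    · rw [hfq, hxc, hyc, ← add_mul, hab, one_mul]
  · intro hVc
    have hqc : f q = c := convexHull_min (show (V : Set E) ⊆ {z | f z = c} from hVc)
      (convex_hyperplane f.isLinear c) h.mem_convexHull
    have hsum : a * (c - f x) + b * (c - f y) = 0 := by
      linear_combination hfq - hqc + c * hab
    have hx0 := mul_nonneg ha.le (sub_nonneg.2 hx)
    have hy0 := mul_nonneg hb.le (sub_nonneg.2 hy)
    constructor
    · exact (sub_eq_zero.1 <|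
        (mul_eq_zero.1 (by linarith : a * (c - f x) = 0)).resolve_left ha.ne').symm
    · exact (sub_eq_zero.1 <|
        (mul_eq_zero.1 (by linarith : b * (c - f y) = 0)).resolve_left hb.ne').symm

theorem exists_supporting (h : IsBipyramidJoin V A x y q) (U : Set E)
    (hU : (x ∈ U ∧ y ∈ U) ↔ ∀ v ∈ V, v ∈ U) :
    ∃ (f : E →ₗ[ℝ] ℝ) (c : ℝ), ∀ p ∈ (insert x (insert y (V ∪ A)) : Set E),
      f p ≤ c ∧ (f p = c ↔ p ∈ U) := by
  classical
  obtain ⟨a, b, ha, hb, hab, hq⟩ := h.mem_openSegment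
  obtain ⟨f₀, c₀, hf₀⟩ := exists_affine_eq_of_affineIndependent h.indep_left
    fun p => if p ∈ U then 0 else 1
  have hV₀ : ∀ v ∈ V, c₀ - f₀ v = if v ∈ U then 0 else 1 := fun v hv =>
    hf₀ v (Or.inr (Or.inl hv))
  have hV₀le : ∀ v ∈ V, f₀ v ≤ c₀ := fun v hv => by
    have := hV₀ v hv
    split_ifs at this <;> linarith
  have hσ : 0 ≤ c₀ - f₀ q := sub_nonneg.2 <|
    convexHull_min (show (V : Set E) ⊆ {z | f₀ z ≤ c₀} from hV₀le)
      (convex_halfSpace_le f₀.isLinear c₀) h.mem_convexHull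
  have hσ0 : c₀ - f₀ q = 0 ↔ ∀ v ∈ V, v ∈ U := by
    constructor
    · intro h0 v hv
      have := eq_of_isMax_of_mem_intrinsicInterior h.mem_intrinsicInterior f₀ c₀
        (fun z hz => convexHull_min hV₀le (convex_halfSpace_le f₀.isLinear c₀) hz)
        (by linarith) (subset_convexHull ℝ _ hv)
      by_contra hvU
      have h1 := hV₀ v hv
      rw [if_neg hvU] at h1
      linarith
    · intro hVU
      have : f₀ q = c₀ := convexHull_min (show (V : Set E) ⊆ {z | f₀ z = c₀} from fun v hv => by
          have h1 := hV₀ v hv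
          rw [if_pos (hVU v hv)] at h1
          exact (sub_eq_zero.1 h1).symm)
        (convex_hyperplane f₀.isLinear c₀) h.mem_convexHull
      linarith
  set σ := c₀ - f₀ q with hσdef
  obtain ⟨gx, gy, hgx, hgy, hgx0, hgy0, hg⟩ : ∃ gx gy : ℝ, 0 ≤ gx ∧ 0 ≤ gy ∧
      (gx = 0 ↔ x ∈ U) ∧ (gy = 0 ↔ y ∈ U) ∧ a * gx + b * gy = σ := by
    rw [← hσ0] at hU
    by_cases hx : x ∈ U <;> by_cases hy : y ∈ U
    · exact ⟨0, 0, le_rfl, le_rfl, by simpa, by simpa, by rw [hU.1 ⟨hx, hy⟩]; ring⟩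
    · have hσne : σ ≠ 0 := fun h0 => hy (hU.2 h0).2
      exact ⟨0, σ / b, le_rfl, by positivity, by simpa, by simp [hσne, hb.ne', hy],
        by field_simp; ring⟩
    · have hσne : σ ≠ 0 := fun h0 => hx (hU.2 h0).1
      exact ⟨σ / a, 0, by positivity, le_rfl, by simp [hσne, ha.ne', hx], by simpa,
        by field_simp; ring⟩
    · have hσne : σ ≠ 0 := fun h0 => hx (hU.2 h0).1
      exact ⟨σ, σ, hσ, hσ, by simp [hσne, hx], by simp [hσne, hy],
        by rw [← add_mul, hab, one_mul]⟩
  obtain ⟨f, c, hf⟩ := exists_affine_eq_of_affineIndependent h.indep_left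
    fun p => if p = x then gx else if p ∈ U then 0 else 1
  have hfx : c - f x = gx := by simpa using hf x (Set.mem_insert x _)
  have hfVA : ∀ p ∈ (V ∪ A : Set E), c - f p = if p ∈ U then 0 else 1 := fun p hp => by
    have hpx : p ≠ x := fun e => h.left_notMem (e ▸ hp)
    simpa [hpx] using hf p (Or.inr hp)
  have hfq : c - f q = σ := by
    have : (f - f₀) q = c - c₀ := convexHull_min
      (show (V : Set E) ⊆ {z | (f - f₀) z = c - c₀} from fun v hv => by
        have h1 := hV₀ v hv
        have h2 := hfVA v (Or.inl hv)
        simp only [Set.mem_ofPred_eq, LinearMap.sub_apply]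
        linarith)
      (convex_hyperplane (f - f₀).isLinear _) h.mem_convexHull
    rw [LinearMap.sub_apply] at this
    linarith
  have hfy : c - f y = gy := by
    have : f q = a * f x + b * f y := by simp [← hq]
    have h1 : b * (c - f y) = b * gy := by
      linear_combination hfq - hg - a * hfx + this + c * hab
    exact mul_left_cancel₀ hb.ne' h1
  refine ⟨f, c, ?_⟩
  rintro p (rfl | rfl | hp)
  · exact ⟨by linarith, by rw [← hgx0, ← hfx, sub_eq_zero, eq_comm]⟩
  · exact ⟨by linarith, by rw [← hgy0, ← hfy, sub_eq_zero, eq_comm]⟩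
  · have h1 := hfVA p hp
    by_cases hpU : p ∈ U
    · rw [if_pos hpU] at h1
      exact ⟨by linarith, iff_of_true (by linarith) hpU⟩
    · rw [if_neg hpU] at h1
      exact ⟨by linarith, iff_of_false (by linarith) hpU⟩

theorem finrank_add_one (h : IsBipyramidJoin V A x y q) {U : Finset E} (hne : U.Nonempty)
    (hU : (U : Set E) ⊆ insert x (insert y (V ∪ A))) (hxy : ¬ (x ∈ U ∧ y ∈ U)) :
    Module.finrank ℝ (affineSpan ℝ (U : Set E)).direction + 1 = U.card := by
  refine finrank_direction_affineSpan_add_one hne ?_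
  by_cases hx : x ∈ U
  · refine h.indep_left.mono fun p hp => ?_
    rcases hU hp with rfl | rfl | hp'
    · exact Or.inl rfl
    · exact absurd ⟨hx, hp⟩ hxy
    · exact Or.inr hp'
  · refine h.indep_right.mono fun p hp => ?_
    rcases hU hp with rfl | hp'
    · exact absurd hp hx
    · exact hp'

theorem mem_affineSpan (h : IsBipyramidJoin V A x y q) :
    y ∈ affineSpan ℝ (insert x (V : Set E)) := by
  obtain ⟨a, b, ha, hb, hab, hq⟩ := h.mem_openSegment
  have hqV : q ∈ affineSpan ℝ (insert x (V : Set E)) :=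
    affineSpan_mono ℝ (Set.subset_insert x _) (convexHull_subset_affineSpan _ h.mem_convexHull)
  have hx : x ∈ affineSpan ℝ (insert x (V : Set E)) :=
    subset_affineSpan ℝ _ (Set.mem_insert x _)
  have hy : y = AffineMap.lineMap x q b⁻¹ := by
    rw [AffineMap.lineMap_apply, ← hq, eq_sub_of_add_eq hab, vsub_eq_sub, vadd_eq_add]
    have : ((1 - b) • x + b • y - x) = b • (y - x) := by module
    rw [this, inv_smul_smul₀ hb.ne']
    abel
  rw [hy]
  exact AffineMap.lineMap_mem _ hx hqV

theorem finrank_add_two (h : IsBipyramidJoin V A x y q) {U : Finset E}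
    (hU : (U : Set E) ⊆ insert x (insert y (V ∪ A))) (hx : x ∈ U) (hy : y ∈ U) (hV : V ⊆ U) :
    Module.finrank ℝ (affineSpan ℝ (U : Set E)).direction + 2 = U.card := by
  classical
  have hxe : x ∈ U.erase y := Finset.mem_erase.2 ⟨h.ne, hx⟩
  have hspan : affineSpan ℝ (U : Set E) = affineSpan ℝ (U.erase y : Set E) := by
    refine le_antisymm (affineSpan_le.2 fun p hp => ?_)
      (affineSpan_mono ℝ (Finset.coe_subset.2 (U.erase_subset y)))
    by_cases hpy : p = y
    · subst hpy
      refine affineSpan_mono ℝ (Set.insert_subset hxe fun v hv => ?_) h.mem_affineSpan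
      exact Finset.mem_erase.2 ⟨fun e => h.right_notMem (Or.inl (e ▸ hv)), hV hv⟩
    · exact subset_affineSpan ℝ _ (Finset.mem_erase.2 ⟨hpy, hp⟩)
  have := h.finrank_add_one ⟨x, hxe⟩
    ((Finset.coe_subset.2 (U.erase_subset y)).trans hU) (by simp)
  rw [hspan, ← Finset.card_erase_add_one hy, ← this]

theorem insert_apex (h : IsBipyramidJoin V A x y q) [DecidableEq E] {z : E}
    (hz : z ∉ affineSpan ℝ (insert x (insert y (V ∪ A)) : Set E)) :
    IsBipyramidJoin V (insert z A) x y q := by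
  have hz' : z ∉ (insert x (insert y (V ∪ A)) : Set E) := fun h => hz (subset_affineSpan ℝ _ h)
  have hswap : (V : Set E) ∪ (insert z A : Finset E) = insert z ((V : Set E) ∪ A) := by
    rw [Finset.coe_insert, Set.union_insert]
  refine ⟨?_, ?_, ?_, h.ne, ?_, ?_, h.mem_openSegment, h.mem_intrinsicInterior⟩
  · rw [Finset.disjoint_insert_right]
    exact ⟨fun hv => hz' (Or.inr (Or.inr (Or.inl hv))), h.disjoint⟩
  · rw [hswap]
    rintro (rfl | hx)
    exacts [hz' (Or.inl rfl), h.left_notMem hx]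
  · rw [hswap]
    rintro (rfl | hx)
    exacts [hz' (Or.inr (Or.inl rfl)), h.right_notMem hx]
  · rw [hswap, Set.insert_comm]
    refine affineIndependent_insert_of_notMem_affineSpan h.indep_left fun hm => hz ?_
    exact affineSpan_mono ℝ (Set.insert_subset_insert (Set.subset_insert _ _)) hm
  · rw [hswap, Set.insert_comm]
    refine affineIndependent_insert_of_notMem_affineSpan h.indep_right fun hm => hz ?_
    exact affineSpan_mono ℝ (Set.subset_insert _ _) hm

end IsBipyramidJoin

theorem exists_isBipyramidJoin {M : ℕ} {S B : Set (EuclideanSpace ℝ (Fin M))} {n : ℕ}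
    (hS : IsSimplex S n) (hB : IsBipyramid B S) :
    ∃ (V : Finset (EuclideanSpace ℝ (Fin M))) (x y q : EuclideanSpace ℝ (Fin M)),
      V.card = n + 1 ∧
      ∀ r Q, IsFoldPyramid r Q B → ∃ A : Finset (EuclideanSpace ℝ (Fin M)), A.card = r ∧
        IsBipyramidJoin V A x y q ∧
        Q = convexHull ℝ (insert x (insert y ((V : Set (EuclideanSpace ℝ (Fin M))) ∪ A))) := by
  classical
  obtain ⟨V, hVcard, hV, rfl⟩ := hS
  obtain ⟨x, y, hx, hy, ⟨q, hqxy, hqV⟩, rfl⟩ := hB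
  rw [affineSpan_convexHull] at hx hy
  have hbase : IsBipyramidJoin V ∅ x y q := by
    refine ⟨Finset.disjoint_empty_right V, ?_, ?_, ?_, ?_, ?_, hqxy, hqV⟩
    · rw [Finset.coe_empty, Set.union_empty]
      exact fun h => hx (subset_affineSpan ℝ _ h)
    · rw [Finset.coe_empty, Set.union_empty]
      exact fun h => hy (subset_affineSpan ℝ _ h)
    · rintro rfl
      rw [openSegment_same, Set.mem_singleton_iff] at hqxy
      exact hx (hqxy ▸ convexHull_subset_affineSpan _ (intrinsicInterior_subset hqV))
    · rw [Finset.coe_empty, Set.union_empty]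
      exact affineIndependent_insert_of_notMem_affineSpan hV hx
    · rw [Finset.coe_empty, Set.union_empty]
      exact affineIndependent_insert_of_notMem_affineSpan hV hy
  refine ⟨V, x, y, q, hVcard, fun r => ?_⟩
  induction r with
  | zero =>
    rintro Q rfl
    refine ⟨∅, rfl, hbase, ?_⟩
    rw [Finset.coe_empty, Set.union_empty, convexHull_convexHull_union_left]
    congr 1
    ext; simp
  | succ r ih =>
    rintro Q ⟨R, hR, z, hz, rfl⟩
    obtain ⟨A, hA, hjoin, rfl⟩ := ih R hR
    rw [affineSpan_convexHull] at hz
    refine ⟨insert z A, ?_, hjoin.insert_apex hz, ?_⟩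
    · rw [Finset.card_insert_of_notMem, hA]
      exact fun h => hz (subset_affineSpan ℝ _ (Or.inr (Or.inr (Or.inr h))))
    · rw [Set.insert_eq, convexHull_convexHull_union_right]
      congr 1
      ext; simp

theorem card_filter_not_subset {α : Type*} [DecidableEq α] {W P R : Finset α} (hP : P ⊆ W)
    (hR : R ⊆ W) (n : ℕ) :
    ((W.powersetCard n).filter fun T => ¬ T ⊆ P ∧ ¬ T ⊆ R).card +
      (P.card.choose n + R.card.choose n) = W.card.choose n + (P ∩ R).card.choose n := by
  have hbad : ((W.powersetCard n).filter fun T => ¬ (¬ T ⊆ P ∧ ¬ T ⊆ R)) =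
      P.powersetCard n ∪ R.powersetCard n := by
    ext T
    simp only [Finset.mem_filter, Finset.mem_powersetCard, Finset.mem_union]
    constructor
    · rintro ⟨⟨-, hc⟩, h⟩
      tauto
    · rintro (⟨h, hc⟩ | ⟨h, hc⟩)
      · exact ⟨⟨h.trans hP, hc⟩, by tauto⟩
      · exact ⟨⟨h.trans hR, hc⟩, by tauto⟩
  have hinter : P.powersetCard n ∩ R.powersetCard n = (P ∩ R).powersetCard n := by
    ext T
    simp only [Finset.mem_inter, Finset.mem_powersetCard, Finset.subset_inter_iff]
    tauto
  have h1 := Finset.card_filter_add_card_filter_not (s := W.powersetCard n)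
    fun T => ¬ T ⊆ P ∧ ¬ T ⊆ R
  have h2 := Finset.card_union_add_card_inter (P.powersetCard n) (R.powersetCard n)
  rw [hinter] at h2
  rw [hbad] at h1
  simp only [Finset.card_powersetCard] at h1 h2
  omega

/-- Faces are counted by the sets `T` of vertices they omit: a simplex face omits an apex of the
bipyramid and a vertex of the simplex, any other face omits only apices of the pyramids. -/
theorem IsBipyramidJoin.fCount_eq {M : ℕ} [DecidableEq (EuclideanSpace ℝ (Fin M))]
    {V A : Finset (EuclideanSpace ℝ (Fin M))} {x y q : EuclideanSpace ℝ (Fin M)}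
    (h : IsBipyramidJoin V A x y q) {m k : ℕ} (hcard : V.card + A.card = m + k + 1) :
    fCount (convexHull ℝ (insert x (insert y ((V : Set (EuclideanSpace ℝ (Fin M))) ∪ A)))) m =
      (((insert x (insert y (V ∪ A))).powersetCard (k + 2)).filter
        fun T => ¬ T ⊆ V ∪ A ∧ ¬ T ⊆ insert x (insert y A)).card + A.card.choose (k + 1) := by
  set W : Finset (EuclideanSpace ℝ (Fin M)) := insert x (insert y (V ∪ A)) with hW
  have hWcoe : insert x (insert y ((V : Set (EuclideanSpace ℝ (Fin M))) ∪ A)) = W := by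
    simp [hW]
  have hxVA : x ∉ V ∪ A := by simpa using h.left_notMem
  have hyVA : y ∉ V ∪ A := by simpa using h.right_notMem
  have hWcard : W.card = m + k + 3 := by
    rw [hW, Finset.card_insert_of_notMem, Finset.card_insert_of_notMem hyVA,
      Finset.card_union_of_disjoint h.disjoint, hcard]
    rw [Finset.mem_insert, not_or]
    exact ⟨h.ne, hxVA⟩
  have hxW : x ∈ W := by simp [hW]
  have hyW : y ∈ W := by simp [hW]
  have hVW : V ⊆ W := fun v hv => by simp [hW, hv]
  -- A face omits one of `x`, `y` iff it omits a vertex of the simplex.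
  have hmissxy : ∀ T ⊆ W, T ⊆ V ∪ A ↔ x ∈ W \ T ∧ y ∈ W \ T := by
    intro T hT
    simp only [Finset.mem_sdiff, hxW, hyW, true_and]
    refine ⟨fun hTs => ⟨fun hm => hxVA (hTs hm), fun hm => hyVA (hTs hm)⟩, ?_⟩
    rintro ⟨hxT, hyT⟩ p hp
    rcases Finset.mem_insert.1 (hT hp) with rfl | hp'
    · exact absurd hp hxT
    rcases Finset.mem_insert.1 hp' with rfl | hp''
    · exact absurd hp hyT
    · exact hp''
  have hmissV : ∀ T ⊆ W, T ⊆ insert x (insert y A) ↔ ∀ v ∈ V, v ∈ W \ T := by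
    intro T hT
    constructor
    · intro hTs v hv
      refine Finset.mem_sdiff.2 ⟨hVW hv, fun hvT => ?_⟩
      have := hTs hvT
      simp only [Finset.mem_insert] at this
      rcases this with rfl | rfl | hvA
      · exact hxVA (Finset.mem_union_left _ hv)
      · exact hyVA (Finset.mem_union_left _ hv)
      · exact Finset.disjoint_left.1 h.disjoint hv hvA
    · intro hTV p hp
      have hpV : p ∉ V := fun hv => (Finset.mem_sdiff.1 (hTV p hv)).2 hp
      have := hT hp
      simp only [hW, Finset.mem_insert, Finset.mem_union] at this ⊢
      tauto
  have hAiff : ∀ T, T ⊆ A ↔ T ⊆ V ∪ A ∧ T ⊆ insert x (insert y A) := by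
    intro T
    constructor
    · exact fun hT => ⟨hT.trans Finset.subset_union_right,
        hT.trans ((Finset.subset_insert _ _).trans (Finset.subset_insert _ _))⟩
    · rintro ⟨h1, h2⟩ p hp
      have h1p := h1 hp
      have h2p := h2 hp
      simp only [Finset.mem_insert] at h2p
      rcases h2p with rfl | rfl | h2p
      · exact absurd h1p hxVA
      · exact absurd h1p hyVA
      · exact h2p
  have hAW : A ⊆ W := fun p hp => by simp [hW, hp]
  have hdisj : Disjoint ((W.powersetCard (k + 2)).filter
      fun T => ¬ T ⊆ V ∪ A ∧ ¬ T ⊆ insert x (insert y A)) (A.powersetCard (k + 1)) := by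
    refine Finset.disjoint_left.2 fun T h1 h2 => ?_
    have h1c := (Finset.mem_powersetCard.1 (Finset.mem_filter.1 h1).1).2
    have h2c := (Finset.mem_powersetCard.1 h2).2
    omega
  rw [← Finset.card_powersetCard, ← Finset.card_union_of_disjoint hdisj, hWcoe]
  set 𝒯 := ((W.powersetCard (k + 2)).filter
      fun T => ¬ T ⊆ V ∪ A ∧ ¬ T ⊆ insert x (insert y A)) ∪ A.powersetCard (k + 1) with h𝒯
  have hsupp : ∀ T ⊆ W, (T ⊆ V ∪ A ↔ T ⊆ insert x (insert y A)) →
      ∃ (f : EuclideanSpace ℝ (Fin M) →ₗ[ℝ] ℝ) (c : ℝ), (∀ p ∈ W, f p ≤ c) ∧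
        (∀ p ∈ W, f p = c ↔ p ∈ W \ T) ∧
        {z ∈ convexHull ℝ (W : Set (EuclideanSpace ℝ (Fin M))) | f z = c} =
          convexHull ℝ ((W \ T : Finset _) : Set (EuclideanSpace ℝ (Fin M))) := by
    intro T hT hiff
    rw [hmissxy T hT, hmissV T hT] at hiff
    obtain ⟨f, c, hf⟩ := h.exists_supporting ((W \ T : Finset _) : Set _) hiff
    rw [hWcoe] at hf
    refine ⟨f, c, fun p hp => (hf p hp).1, fun p hp => (hf p hp).2, ?_⟩
    rw [convexHull_inter_hyperplane_eq W f c fun p hp => (hf p hp).1]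
    congr 1
    ext p
    exact ⟨fun hp => (hf p hp.1).2.1 hp.2,
      fun hp => ⟨(Finset.mem_sdiff.1 hp).1, (hf p (Finset.mem_sdiff.1 hp).1).2.2 hp⟩⟩
  have hdim : ∀ T ⊆ W, (T ⊆ V ∪ A ↔ T ⊆ insert x (insert y A)) → T ≠ W →
      (pdim (convexHull ℝ ((W \ T : Finset _) : Set (EuclideanSpace ℝ (Fin M)))) = m ↔ T ∈ 𝒯) := by
    intro T hT hiff hne
    have hUne : (W \ T).Nonempty := Finset.sdiff_nonempty.2 fun hWT => hne (hT.antisymm hWT)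
    have hUW : ((W \ T : Finset _) : Set (EuclideanSpace ℝ (Fin M))) ⊆
        insert x (insert y ((V : Set (EuclideanSpace ℝ (Fin M))) ∪ A)) := by
      rw [hWcoe]
      exact Finset.coe_subset.2 Finset.sdiff_subset
    have hc := Finset.card_sdiff_add_card_eq_card hT
    rw [pdim, affineSpan_convexHull, h𝒯, Finset.mem_union, Finset.mem_filter,
      Finset.mem_powersetCard, Finset.mem_powersetCard, hAiff]
    by_cases hTs : T ⊆ V ∪ A
    · have hTs' := hiff.1 hTs
      obtain ⟨hxU, hyU⟩ := (hmissxy T hT).1 hTs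
      have hrank := h.finrank_add_two hUW hxU hyU fun v hv => (hmissV T hT).1 hTs' v hv
      simp only [hTs, hTs', not_true_eq_false, and_self, and_false, false_or, true_and]
      omega
    · have hTs' : ¬ T ⊆ insert x (insert y A) := fun h' => hTs (hiff.2 h')
      have hrank := h.finrank_add_one hUne hUW fun hxy => hTs ((hmissxy T hT).2 hxy)
      simp only [hT, hTs, hTs', not_false_eq_true, and_self, false_and, or_false, true_and, and_true]
      omega
  have h𝒯mem : ∀ T ∈ 𝒯, T ⊆ W ∧ (T ⊆ V ∪ A ↔ T ⊆ insert x (insert y A)) ∧ T ≠ W := by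
    intro T hT
    rcases Finset.mem_union.1 hT with hT | hT
    · obtain ⟨hT, h1, h2⟩ := Finset.mem_filter.1 hT
      obtain ⟨hTW, hTc⟩ := Finset.mem_powersetCard.1 hT
      exact ⟨hTW, iff_of_false h1 h2, by rintro rfl; omega⟩
    · obtain ⟨hTA, hTc⟩ := Finset.mem_powersetCard.1 hT
      obtain ⟨h1, h2⟩ := (hAiff T).1 hTA
      exact ⟨hTA.trans hAW, iff_of_true h1 h2, by rintro rfl; omega⟩
  rw [fCount, ← Set.ncard_coe_finset 𝒯]
  refine (Set.ncard_congr (fun T _ => convexHull ℝ ((W \ T : Finset _) : Set _)) ?_ ?_ ?_).symm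
  · intro T hT
    obtain ⟨hTW, hiff, hne⟩ := h𝒯mem T hT
    obtain ⟨f, c, hle, -, hface⟩ := hsupp T hTW hiff
    refine ⟨⟨f, c, ?_, hface.symm⟩, ?_, (hdim T hTW hiff hne).2 hT⟩
    · exact convexHull_min (show (W : Set _) ⊆ {z | f z ≤ c} from hle)
        (convex_halfSpace_le f.isLinear c)
    · exact (Finset.coe_nonempty.2 <| Finset.sdiff_nonempty.2 fun hWT =>
        hne (hTW.antisymm hWT)).convexHull
  · have hrecover : ∀ T ∈ 𝒯, ∀ p, p ∈ T ↔ p ∈ W ∧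
        p ∉ convexHull ℝ ((W \ T : Finset _) : Set (EuclideanSpace ℝ (Fin M))) := by
      intro T hT p
      obtain ⟨hTW, hiff, -⟩ := h𝒯mem T hT
      obtain ⟨f, c, -, htight, hface⟩ := hsupp T hTW hiff
      constructor
      · refine fun hp => ⟨hTW hp, fun hm => ?_⟩
        rw [← hface] at hm
        exact (Finset.mem_sdiff.1 ((htight p (hTW hp)).1 hm.2)).2 hp
      · rintro ⟨hpW, hp⟩
        by_contra hpT
        exact hp (subset_convexHull ℝ _ (Finset.mem_sdiff.2 ⟨hpW, hpT⟩))
    intro T T' hT hT' heq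
    ext p
    rw [hrecover T hT, hrecover T' hT']
    rw [heq]
  · rintro F ⟨⟨f, c, hle, rfl⟩, hFne, hFdim⟩
    have hleW : ∀ p ∈ W, f p ≤ c := fun p hp => hle p (subset_convexHull ℝ _ hp)
    set T := W.filter fun p => f p ≠ c with hTdef
    have hTW : T ⊆ W := Finset.filter_subset _ _
    have hmem : ∀ p ∈ W, (p ∈ W \ T ↔ f p = c) := fun p hp => by simp [hTdef, hp]
    have hF : {z ∈ convexHull ℝ (W : Set (EuclideanSpace ℝ (Fin M))) | f z = c} =
        convexHull ℝ ((W \ T : Finset _) : Set (EuclideanSpace ℝ (Fin M))) := by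
      rw [convexHull_inter_hyperplane_eq W f c hleW]
      congr 1
      ext p
      exact ⟨fun hp => (hmem p hp.1).2 hp.2, fun hp => ⟨(Finset.mem_sdiff.1 hp).1,
        (hmem p (Finset.mem_sdiff.1 hp).1).1 hp⟩⟩
    have hiff : T ⊆ V ∪ A ↔ T ⊆ insert x (insert y A) := by
      rw [hmissxy T hTW, hmissV T hTW, hmem x hxW, hmem y hyW,
        h.tight_apices_iff f c (fun v hv => hleW v (hVW hv)) (hleW x hxW) (hleW y hyW)]
      exact forall₂_congr fun v hv => (hmem v (hVW hv)).symm
    rw [hF] at hFne hFdim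
    have hne : T ≠ W := by
      intro hTeq
      rw [hTeq, Finset.sdiff_self, Finset.coe_empty, convexHull_empty] at hFne
      exact Set.not_nonempty_empty hFne
    exact ⟨T, (hdim T hTW hiff hne).1 hFdim, hF.symm⟩

theorem C_natCast (n m : ℕ) : C n m = n.choose m := by
  simp [C]

theorem stmt10 {M : ℕ} (S B Q : Set (EuclideanSpace ℝ (Fin M))) (d s k : ℕ)
    (hs : 2 ≤ s) (hsd : s ≤ d) (hk1 : 1 ≤ k) (hk2 : k ≤ d - 1)
    (hS : IsSimplex S (s - 1)) (hB : IsBipyramid B S) (hQ : IsFoldPyramid (d - s) Q B) :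
    (fCount Q (d - 1 - k) : ℤ) = phi d s k := by
  classical
  obtain ⟨V, x, y, q, hVcard, hfold⟩ := exists_isBipyramidJoin hS hB
  obtain ⟨A, hAcard, h, rfl⟩ := hfold _ Q hQ
  obtain ⟨r, rfl⟩ := Nat.exists_eq_add_of_le hsd
  have hAr : A.card = r := by omega
  have hVs : V.card = s := by omega
  rw [h.fCount_eq (k := k) (by omega)]
  have hxVA : x ∉ V ∪ A := by simpa using h.left_notMem
  have hyVA : y ∉ V ∪ A := by simpa using h.right_notMem
  have hxyVA : x ∉ insert y (V ∪ A) := by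
    rw [Finset.mem_insert, not_or]
    exact ⟨h.ne, hxVA⟩
  have hinter : (V ∪ A) ∩ insert x (insert y A) = A := by
    rw [Finset.inter_insert_of_notMem hxVA, Finset.inter_insert_of_notMem hyVA]
    exact Finset.inter_eq_right.2 Finset.subset_union_right
  have hcount := card_filter_not_subset
    (show V ∪ A ⊆ insert x (insert y (V ∪ A)) from
      (Finset.subset_insert _ _).trans (Finset.subset_insert _ _))
    (show insert x (insert y A) ⊆ insert x (insert y (V ∪ A)) from
      Finset.insert_subset_insert _ (Finset.insert_subset_insert _ Finset.subset_union_right))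
    (k + 2)
  have hyA : y ∉ A := fun hm => hyVA (Finset.mem_union_right _ hm)
  have hxyA : x ∉ insert y A := fun hm =>
    hxyVA (Finset.insert_subset_insert _ Finset.subset_union_right hm)
  have hVA : (V ∪ A).card = s + r := by
    rw [Finset.card_union_of_disjoint h.disjoint, hVs, hAr]
  rw [hinter, Finset.card_insert_of_notMem hxyA, Finset.card_insert_of_notMem hyA,
    Finset.card_insert_of_notMem hxyVA, Finset.card_insert_of_notMem hyVA, hVA, hAr] at hcount
  have e1 := Nat.choose_succ_succ (s + r + 1) (k + 1)
  have e2 := Nat.choose_succ_succ (s + r) (k + 1)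
  have e3 := Nat.choose_succ_succ (r + 1) (k + 1)
  have e4 := Nat.choose_succ_succ r (k + 1)
  have hC1 : C (((s + r : ℕ) : ℤ) + 1) (k + 1) = (s + r + 1).choose (k + 1) := by
    rw [← C_natCast]; push_cast; rfl
  have hC2 : C (((s + r : ℕ) : ℤ) + 1 - s) (k + 1) = (r + 1).choose (k + 1) := by
    rw [← C_natCast]
    congr 1
    push_cast
    ring
  rw [phi, hC1, hC2, C_natCast, hAr]
  simp only [Nat.succ_eq_add_one, add_assoc, Nat.reduceAdd] at *
  omega
end
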